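/- arXiv:0909.0319 — 3 statements merged into one kernel-verified Lean document; each statement's English description precedes it below -/
import Mathlib

section
/- Let F*⊕𝒢⊕F carry a Courant algebroid structure with anchor ρ(ξ+r+x) = x, pseudo-metric ⟨ξ₁+r₁+x₁,ξ₂+r₂+x₂⟩ = ½⟨ξ₁,x₂⟩ + ½⟨ξ₂,x₁⟩ + ⟨r₁,r₂⟩_𝒢, and satisfying pr_𝒢(r₁∘r₂) = [r₁,r₂]_𝒢, and let ∇, R, ℋ be the induced data. Then: (i) x⟨r,s⟩_𝒢 = ⟨∇_x r,s⟩_𝒢 + ⟨r,∇_x s⟩_𝒢; (ii) ∇_x[r,s]_𝒢 = [∇_x r,s]_𝒢 + [r,∇_x s]_𝒢; (iii) (∇_x R(y,z) − R([x,y],z)) + c.p. = 0; (iv) ∇_x∇_y r − ∇_y∇_x r − ∇_{[x,y]}r = [R(x,y),r]_𝒢; and (v) d^Fℋ = ⟨R∧R⟩, where ⟨R∧R⟩(x₁,x₂,x₃,x₄) = ¼Σ_{σ∈S₄} sgn(σ)⟨R(x_{σ(1)},x_{σ(2)}),R(x_{σ(3)},x_{σ(4)})⟩_𝒢, for all x,y,z,xᵢ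 ∈ Γ(F) and r,s ∈ Γ(𝒢). -/
/-! # Statement 9
A standard Courant algebroid structure on `F*⊕𝒢⊕F` induces data `∇, R, ℋ`
satisfying the five compatibility conditions (i)-(v), in particular `d^Fℋ = ⟨R∧R⟩`.

Algebraic model: `A` plays the role of `C^∞(M)`, vector fields are
`Derivation ℝ A A`, `F` is a bracket-closed `A`-submodule of `Derivation ℝ A A`,
and the module of sections of `F*⊕𝒢⊕F` is `Module.Dual A F × G × F`. -/

/-- A Courant algebroid (in algebraic form). -/
structure CourantAlgebroid (A : Type) [CommRing A] [Algebra ℝ A]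
    (E : Type) [AddCommGroup E] [Module A E] [Module ℝ E] [IsScalarTower ℝ A E] where
  /-- the pseudo-metric `⟨-,-⟩` -/
  ip : E →ₗ[A] E →ₗ[A] A
  /-- the anchor `ρ` -/
  rho : E →ₗ[A] Derivation ℝ A A
  /-- the Dorfman bracket `∘` (ℝ-bilinear) -/
  dorf : E →ₗ[ℝ] E →ₗ[ℝ] E
  /-- the map `𝒟 : C^∞(M) → Γ(E)` -/
  Dmap : A → E
  ip_symm : ∀ e₁ e₂, ip e₁ e₂ = ip e₂ e₁
  /-- fiberwise nondegeneracy of the pseudo-metric: `Ξ : E → E*` is bijective -/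
  ip_nondeg : Function.Bijective fun e => ip e
  /-- `⟨𝒟f, e⟩ = ½ ρ(e) f` -/
  ip_D : ∀ (f : A) (e : E), (2 : A) * ip (Dmap f) e = rho e f
  /-- `ρ ∘ 𝒟 = 0` -/
  rho_D : ∀ f : A, rho (Dmap f) = 0
  dorf_jacobi : ∀ e₁ e₂ e₃,
    dorf e₁ (dorf e₂ e₃) = dorf (dorf e₁ e₂) e₃ + dorf e₂ (dorf e₁ e₃)
  rho_dorf : ∀ e₁ e₂, rho (dorf e₁ e₂) = ⁅rho e₁, rho e₂⁆
  dorf_leibniz : ∀ (e₁ : E) (f : A) (e₂ : E),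
    dorf e₁ (f • e₂) = rho e₁ f • e₂ + f • dorf e₁ e₂
  dorf_sym : ∀ e₁ e₂, dorf e₁ e₂ + dorf e₂ e₁ = (2 : ℝ) • Dmap (ip e₁ e₂)
  dorf_D : ∀ (f : A) (e : E), dorf (Dmap f) e = 0
  rho_ip : ∀ e₁ e₂ e₃,
    rho e₁ (ip e₂ e₃) = ip (dorf e₁ e₂) e₃ + ip e₂ (dorf e₁ e₃)

namespace CourantAlgebroid

variable {A : Type} [CommRing A] [Algebra ℝ A]
variable {E : Type} [AddCommGroup E] [Module A E] [Module ℝ E] [IsScalarTower ℝ A E]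
variable (ca : CourantAlgebroid A E)

/-- `(ker ρ)⊥`, the subbundle of `E` orthogonal to `ker ρ` w.r.t. the pseudo-metric. -/
def perp : Submodule A E where
  carrier := {e | ∀ k ∈ LinearMap.ker ca.rho, ca.ip e k = 0}
  add_mem' := by
    intro a b ha hb k hk
    simp [map_add, ha k hk, hb k hk]
  zero_mem' := by intro k hk; simp
  smul_mem' := by
    intro c x hx k hk
    simp [map_smul, hx k hk]

/-- Regularity (constant rank of the anchor), expressed by the splitting of the two
canonical short exact sequences `0 → ker ρ → E → F → 0` and
`0 → (ker ρ)⊥ → ker ρ → 𝒢 → 0`. -/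
def IsRegular : Prop :=
  (∃ lam : ↥(LinearMap.range ca.rho) →ₗ[A] E, ∀ x, ca.rho (lam x) = ↑x) ∧
  (∃ sig : (↥(LinearMap.ker ca.rho) ⧸
        (ca.perp.comap (LinearMap.ker ca.rho).subtype)) →ₗ[A] ↥(LinearMap.ker ca.rho),
      ∀ g, (ca.perp.comap (LinearMap.ker ca.rho).subtype).mkQ (sig g) = g)

lemma dorf_mem_ker {r s : E} (hr : r ∈ LinearMap.ker ca.rho)
    (hs : s ∈ LinearMap.ker ca.rho) : ca.dorf r s ∈ LinearMap.ker ca.rho := by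
  rw [LinearMap.mem_ker] at *
  rw [ca.rho_dorf, hr, hs, zero_lie]

lemma dorf_ker_left_mem_ker (e : E) {r : E} (hr : r ∈ LinearMap.ker ca.rho) :
    ca.dorf e r ∈ LinearMap.ker ca.rho := by
  rw [LinearMap.mem_ker] at *
  rw [ca.rho_dorf, hr, lie_zero]

/-- sections of `ker ρ` -/
abbrev Ker := ↥(LinearMap.ker ca.rho)

/-- `(ker ρ)⊥` viewed inside `ker ρ` -/
abbrev perp' : Submodule A ca.Ker := ca.perp.comap (LinearMap.ker ca.rho).subtype

/-- `𝒢 := ker ρ/(ker ρ)⊥` -/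
abbrev Gq := ca.Ker ⧸ ca.perp'

/-- the projection `π : ker ρ → 𝒢` -/
abbrev piG : ca.Ker →ₗ[A] ca.Gq := ca.perp'.mkQ

/-- the ample quotient `𝒜_E := E/(ker ρ)⊥` -/
abbrev Ample := E ⧸ ca.perp

/-- the projection `q : E → 𝒜_E` -/
abbrev qA : E →ₗ[A] ca.Ample := ca.perp.mkQ

/-- Dorfman bracket of two sections of `ker ρ`, viewed in `ker ρ`. -/
def dorfK (r s : ca.Ker) : ca.Ker := ⟨ca.dorf ↑r ↑s, ca.dorf_mem_ker r.2 s.2⟩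

/-- Dorfman bracket of a section of `E` with a section of `ker ρ`, viewed in `ker ρ`. -/
def dorfEK (e : E) (r : ca.Ker) : ca.Ker := ⟨ca.dorf e ↑r, ca.dorf_ker_left_mem_ker e r.2⟩

end CourantAlgebroid

section CE
variable {V A : Type} [CommRing A]

/-- differential of a `1`-form -/
def dCE1 (act : V → A → A) (bk : V → V → V) (ω : V → A) (x₀ x₁ : V) : A :=
  act x₀ (ω x₁) - act x₁ (ω x₀) - ω (bk x₀ x₁)

/-- differential of a `2`-form -/
def dCE2 (act : V → A → A) (bk : V → V → V) (ω : V → V → A) (x₀ x₁ x₂ : V) : A :=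
  act x₀ (ω x₁ x₂) - act x₁ (ω x₀ x₂) + act x₂ (ω x₀ x₁)
    - ω (bk x₀ x₁) x₂ + ω (bk x₀ x₂) x₁ - ω (bk x₁ x₂) x₀

/-- differential of a `3`-form -/
def dCE3 (act : V → A → A) (bk : V → V → V) (ω : V → V → V → A)
    (x₀ x₁ x₂ x₃ : V) : A :=
  act x₀ (ω x₁ x₂ x₃) - act x₁ (ω x₀ x₂ x₃) + act x₂ (ω x₀ x₁ x₃)
    - act x₃ (ω x₀ x₁ x₂)
    - ω (bk x₀ x₁) x₂ x₃ + ω (bk x₀ x₂) x₁ x₃ - ω (bk x₀ x₃) x₁ x₂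
    - ω (bk x₁ x₂) x₀ x₃ + ω (bk x₁ x₃) x₀ x₂ - ω (bk x₂ x₃) x₀ x₁

/-- differential of a `4`-form -/
def dCE4 (act : V → A → A) (bk : V → V → V) (ω : V → V → V → V → A)
    (x₀ x₁ x₂ x₃ x₄ : V) : A :=
  act x₀ (ω x₁ x₂ x₃ x₄) - act x₁ (ω x₀ x₂ x₃ x₄) + act x₂ (ω x₀ x₁ x₃ x₄)
    - act x₃ (ω x₀ x₁ x₂ x₄) + act x₄ (ω x₀ x₁ x₂ x₃)
    - ω (bk x₀ x₁) x₂ x₃ x₄ + ω (bk x₀ x₂) x₁ x₃ x₄ - ω (bk x₀ x₃) x₁ x₂ x₄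
    + ω (bk x₀ x₄) x₁ x₂ x₃
    - ω (bk x₁ x₂) x₀ x₃ x₄ + ω (bk x₁ x₃) x₀ x₂ x₄ - ω (bk x₁ x₄) x₀ x₂ x₃
    - ω (bk x₂ x₃) x₀ x₁ x₄ + ω (bk x₂ x₄) x₀ x₁ x₃
    - ω (bk x₃ x₄) x₀ x₁ x₂

end CE


section StandardCA

variable {A : Type} [CommRing A] [Algebra ℝ A]
variable (F : Submodule A (Derivation ℝ A A))
variable {G : Type} [AddCommGroup G] [Module A G] [Module ℝ G] [IsScalarTower ℝ A G]

/-- the leafwise Lie bracket on the integrable subbundle `F` -/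
def fbk (hF : ∀ x y : ↥F, ⁅(x : Derivation ℝ A A), (y : Derivation ℝ A A)⁆ ∈ F)
    (x y : ↥F) : ↥F :=
  ⟨⁅(x : Derivation ℝ A A), (y : Derivation ℝ A A)⁆, hF x y⟩

/-- the action of vector fields tangent to `F` on functions -/
def fact (x : ↥F) (f : A) : A := (x : Derivation ℝ A A) f

/-- A standard Courant algebroid structure on `F*⊕𝒢⊕F`: the anchor is the projection
onto `F`, the pseudo-metric is `½⟨ξ₁,x₂⟩ + ½⟨ξ₂,x₁⟩ + ⟨r₁,r₂⟩_𝒢`, and the 𝒢-component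
of the Dorfman bracket of sections of 𝒢 is the fiberwise bracket `[-,-]_𝒢`. -/
def IsStandardCA (lG : G → G → G) (ipG : G → G → A)
    (ca : CourantAlgebroid A (Module.Dual A ↥F × G × ↥F)) : Prop :=
  (∀ p, ca.rho p = ↑p.2.2) ∧
  (∀ p q, ca.ip p q =
    (2:ℝ)⁻¹ • p.1 q.2.2 + (2:ℝ)⁻¹ • q.1 p.2.2 + ipG p.2.1 q.2.1) ∧
  (∀ r s : G, (ca.dorf (0, r, 0) (0, s, 0)).2.1 = lG r s)

variable (ca : CourantAlgebroid A (Module.Dual A ↥F × G × ↥F))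

/-- the `F`-connection `∇` on `𝒢` induced by a standard Courant algebroid -/
def sNabla (x : ↥F) (r : G) : G := (ca.dorf (0, 0, x) (0, r, 0)).2.1

/-- the curvature-type bundle map `R : ∧²F → 𝒢` induced by a standard Courant algebroid -/
def sR (x y : ↥F) : G := (ca.dorf (0, 0, x) (0, 0, y)).2.1

/-- the 3-form `ℋ ∈ Γ(∧³F*)` induced by a standard Courant algebroid -/
def sH (x y z : ↥F) : A := (ca.dorf (0, 0, x) (0, 0, y)).1 z

/-- the 4-form `⟨R∧R⟩` on `F` -/
noncomputable def pontR (ipG : G → G → A) (Rm : ↥F → ↥F → G)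
    (x₁ x₂ x₃ x₄ : ↥F) : A :=
  (4:ℝ)⁻¹ • ∑ σ : Equiv.Perm (Fin 4),
    (Equiv.Perm.sign σ : ℤ) •
      ipG (Rm (![x₁, x₂, x₃, x₄] (σ 0)) (![x₁, x₂, x₃, x₄] (σ 1)))
          (Rm (![x₁, x₂, x₃, x₄] (σ 2)) (![x₁, x₂, x₃, x₄] (σ 3)))

end StandardCA

/-- An alternating sum over `S₄` whose summand has the symmetries of `⟨R ∧ R⟩`. -/
lemma sum_perm_four_sign_smul {B : Type*} [AddCommGroup B] (f : Fin 4 → Fin 4 → Fin 4 → Fin 4 → B)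
    (h_skew : ∀ i j k l, f i j k l = - f j i k l) (h_symm : ∀ i j k l, f i j k l = f k l i j) :
    ∑ σ : Equiv.Perm (Fin 4), (Equiv.Perm.sign σ : ℤ) • f (σ 0) (σ 1) (σ 2) (σ 3)
      = (8 : ℤ) • (f 0 1 2 3 - f 0 2 1 3 + f 0 3 1 2) := by
  have h_skew' : ∀ i j k l, f i j k l = - f i j l k := fun i j k l => by
    rw [h_symm i j k l, h_skew, h_symm l k i j]
  have h_list : (Finset.univ : Finset (Equiv.Perm (Fin 4))).val.map
      (fun σ => ((Equiv.Perm.sign σ : ℤ), σ 0, σ 1, σ 2, σ 3)) =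
      {(1, 0, 1, 2, 3), (-1, 0, 1, 3, 2), (-1, 0, 2, 1, 3), (1, 0, 2, 3, 1),
       (1, 0, 3, 1, 2), (-1, 0, 3, 2, 1), (-1, 1, 0, 2, 3), (1, 1, 0, 3, 2),
       (1, 1, 2, 0, 3), (-1, 1, 2, 3, 0), (-1, 1, 3, 0, 2), (1, 1, 3, 2, 0),
       (1, 2, 0, 1, 3), (-1, 2, 0, 3, 1), (-1, 2, 1, 0, 3), (1, 2, 1, 3, 0),
       (1, 2, 3, 0, 1), (-1, 2, 3, 1, 0), (-1, 3, 0, 1, 2), (1, 3, 0, 2, 1),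
       (1, 3, 1, 0, 2), (-1, 3, 1, 2, 0), (-1, 3, 2, 0, 1), (1, 3, 2, 1, 0)} := by
    decide
  have h_sum := congrArg (fun m => (m.map fun t : ℤ × Fin 4 × Fin 4 × Fin 4 × Fin 4 =>
    t.1 • f t.2.1 t.2.2.1 t.2.2.2.1 t.2.2.2.2).sum) h_list
  simp only [Multiset.map_map, Multiset.insert_eq_cons, Multiset.map_cons, Multiset.sum_cons,
    Multiset.map_singleton, Multiset.sum_singleton] at h_sum
  rw [show ∑ σ : Equiv.Perm (Fin 4), (Equiv.Perm.sign σ : ℤ) • f (σ 0) (σ 1) (σ 2) (σ 3) = _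
    from h_sum]
  simp only [h_symm 1 2 0 3, h_symm 1 2 3 0, h_symm 1 3 0 2, h_symm 1 3 2 0, h_symm 2 1 0 3,
    h_symm 2 1 3 0, h_symm 2 3 0 1, h_symm 2 3 1 0, h_symm 3 1 0 2, h_symm 3 1 2 0, h_symm 3 2 0 1,
    h_symm 3 2 1 0, h_skew 1 0, h_skew 2 0, h_skew 3 0, h_skew' 0 1 3 2, h_skew' 0 2 3 1,
    h_skew' 0 3 2 1]
  module
section InducedDataAlgebra

variable {A : Type} [CommRing A] [Algebra ℝ A] {F : Submodule A (Derivation ℝ A A)}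
  {G : Type} [AddCommGroup G] [Module A G] [Module ℝ G] [IsScalarTower ℝ A G]
  {ca : CourantAlgebroid A (Module.Dual A ↥F × G × ↥F)}

lemma fbk_skew (hF : ∀ x y : ↥F, ⁅(x : Derivation ℝ A A), (y : Derivation ℝ A A)⁆ ∈ F)
    (x y : ↥F) : fbk F hF x y = - fbk F hF y x :=
  Subtype.ext (lie_skew _ _).symm

lemma sNabla_zero_left (r : G) : sNabla F ca 0 r = 0 := by
  have h_zero : ((0, 0, 0) : Module.Dual A ↥F × G × ↥F) = 0 := rfl
  rw [sNabla, h_zero, map_zero]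
  rfl

lemma sNabla_zero_right (x : ↥F) : sNabla F ca x 0 = 0 := by
  have h_zero : ((0, 0, 0) : Module.Dual A ↥F × G × ↥F) = 0 := rfl
  rw [sNabla, h_zero, map_zero]
  rfl

lemma sNabla_neg_right (x : ↥F) (r : G) : sNabla F ca x (-r) = - sNabla F ca x r := by
  have h_neg : ((0, -r, 0) : Module.Dual A ↥F × G × ↥F) = -(0, r, 0) := by simp
  rw [sNabla, h_neg, map_neg]
  rfl

lemma sR_zero_right (x : ↥F) : sR F ca x 0 = 0 := by
  have h_zero : ((0, 0, 0) : Module.Dual A ↥F × G × ↥F) = 0 := rfl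
  rw [sR, h_zero, map_zero]
  rfl

lemma sR_neg_right (x y : ↥F) : sR F ca x (-y) = - sR F ca x y := by
  have h_neg : ((0, 0, -y) : Module.Dual A ↥F × G × ↥F) = -(0, 0, y) := by simp
  rw [sR, h_neg, map_neg]
  rfl

end InducedDataAlgebra


lemma two_mul_inv_two_smul {A : Type*} [CommRing A] [Algebra ℝ A] (a : A) :
    2 * ((2 : ℝ)⁻¹ • a) = a := by
  rw [two_mul, ← add_smul]
  norm_num

lemma two_mul_left_cancel_of_real {A : Type*} [CommRing A] [Algebra ℝ A] {a b : A}
    (h : 2 * a = 2 * b) : a = b := by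
  rw [← two_mul_inv_two_smul a, ← two_mul_inv_two_smul b, mul_smul_comm, mul_smul_comm, h]

section InducedData

variable {A : Type} [CommRing A] [Algebra ℝ A] {F : Submodule A (Derivation ℝ A A)}
  {G : Type} [AddCommGroup G] [Module A G] [Module ℝ G] [IsScalarTower ℝ A G]
  {lG : G →ₗ[A] G →ₗ[A] G} {ipG : G →ₗ[A] G →ₗ[A] A}
  {ca : CourantAlgebroid A (Module.Dual A ↥F × G × ↥F)}

namespace IsStandardCA

lemma two_mul_ip (h : IsStandardCA F (fun r s => lG r s) (fun r s => ipG r s) ca)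
    (p q : Module.Dual A ↥F × G × ↥F) :
    2 * ca.ip p q = p.1 q.2.2 + q.1 p.2.2 + 2 * ipG p.2.1 q.2.1 := by
  rw [h.2.1, mul_add, mul_add, two_mul_inv_two_smul, two_mul_inv_two_smul]

/-- Pairing with a section of `F` recovers the `F*`-component. -/
lemma two_mul_ip_inr (h : IsStandardCA F (fun r s => lG r s) (fun r s => ipG r s) ca)
    (e : Module.Dual A ↥F × G × ↥F) (z : ↥F) : 2 * ca.ip e (0, 0, z) = e.1 z := by
  simp [h.two_mul_ip]

/-- Pairing with a section of `𝒢` recovers the `𝒢`-component. -/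
lemma ip_inl (h : IsStandardCA F (fun r s => lG r s) (fun r s => ipG r s) ca)
    (e : Module.Dual A ↥F × G × ↥F) (s : G) : ca.ip e (0, s, 0) = ipG e.2.1 s := by
  rw [h.2.1]
  simp

lemma two_mul_rho_ip (h : IsStandardCA F (fun r s => lG r s) (fun r s => ipG r s) ca)
    (e p q : Module.Dual A ↥F × G × ↥F) :
    fact F e.2.2 (2 * ca.ip p q) =
      2 * ca.ip (ca.dorf e p) q + 2 * ca.ip p (ca.dorf e q) := by
  have h_ip := ca.rho_ip e p q
  rw [h.1] at h_ip
  rw [fact, two_mul, map_add, h_ip]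
  ring

lemma Dmap_fst_apply (h : IsStandardCA F (fun r s => lG r s) (fun r s => ipG r s) ca)
    (f : A) (z : ↥F) : (ca.Dmap f).1 z = fact F z f := by
  rw [← h.two_mul_ip_inr, ca.ip_D, h.1, fact]

lemma Dmap_snd_fst (h : IsStandardCA F (fun r s => lG r s) (fun r s => ipG r s) ca)
    (hG : ∀ r, (∀ s, ipG r s = 0) → r = 0) (f : A) : (ca.Dmap f).2.1 = 0 := by
  refine hG _ fun s => two_mul_left_cancel_of_real ?_
  rw [← h.ip_inl, ca.ip_D, h.1]
  simp

lemma dorf_snd_snd (h : IsStandardCA F (fun r s => lG r s) (fun r s => ipG r s) ca)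
    (hF : ∀ x y : ↥F, ⁅(x : Derivation ℝ A A), (y : Derivation ℝ A A)⁆ ∈ F)
    (p q : Module.Dual A ↥F × G × ↥F) : (ca.dorf p q).2.2 = fbk F hF p.2.2 q.2.2 := by
  apply Subtype.ext
  rw [← h.1, ca.rho_dorf, h.1, h.1, fbk]

lemma dorf_snd_snd_of_right (h : IsStandardCA F (fun r s => lG r s) (fun r s => ipG r s) ca)
    (p q : Module.Dual A ↥F × G × ↥F) (hq : q.2.2 = 0) : (ca.dorf p q).2.2 = 0 := by
  apply Subtype.ext
  rw [← h.1, ca.rho_dorf, h.1, h.1, hq]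
  simp

/-- The `F*`-component of `x ∘ e` for a section `x` of `F`. -/
lemma dorf_inr_fst (h : IsStandardCA F (fun r s => lG r s) (fun r s => ipG r s) ca)
    (hF : ∀ x y : ↥F, ⁅(x : Derivation ℝ A A), (y : Derivation ℝ A A)⁆ ∈ F)
    (x : ↥F) (e : Module.Dual A ↥F × G × ↥F) (z : ↥F) :
    (ca.dorf (0, 0, x) e).1 z = fact F x (e.1 z) - e.1 (fbk F hF x z) - sH F ca x z e.2.2
      - 2 * ipG e.2.1 (sR F ca x z) := by
  have h_rho := h.two_mul_rho_ip (0, 0, x) e (0, 0, z)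
  rw [h.two_mul_ip_inr, h.two_mul_ip_inr, h.two_mul_ip, h.dorf_snd_snd hF] at h_rho
  simp only [sH, sR]
  linear_combination -h_rho

lemma dorf_inr_dorf_fst (h : IsStandardCA F (fun r s => lG r s) (fun r s => ipG r s) ca)
    (hF : ∀ x y : ↥F, ⁅(x : Derivation ℝ A A), (y : Derivation ℝ A A)⁆ ∈ F) (x y z w : ↥F) :
    (ca.dorf (0, 0, x) (ca.dorf (0, 0, y) (0, 0, z))).1 w =
      fact F x (sH F ca y z w) - sH F ca y z (fbk F hF x w) - sH F ca x w (fbk F hF y z)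
        - 2 * ipG (sR F ca y z) (sR F ca x w) := by
  rw [h.dorf_inr_fst hF, h.dorf_snd_snd hF]
  rfl

/-- The `𝒢`-component of `x ∘ e` for a section `x` of `F`. -/
lemma dorf_inr_snd_fst (h : IsStandardCA F (fun r s => lG r s) (fun r s => ipG r s) ca)
    (hF : ∀ x y : ↥F, ⁅(x : Derivation ℝ A A), (y : Derivation ℝ A A)⁆ ∈ F)
    (hG : ∀ r, (∀ s, ipG r s = 0) → r = 0) (hs : ∀ r s, ipG r s = ipG s r)
    (x : ↥F) (e : Module.Dual A ↥F × G × ↥F) :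
    (ca.dorf (0, 0, x) e).2.1 = sNabla F ca x e.2.1 + sR F ca x e.2.2 := by
  rw [← sub_eq_zero]
  refine hG _ fun s => two_mul_left_cancel_of_real ?_
  have h_rho := h.two_mul_rho_ip (0, 0, x) e (0, s, 0)
  have h_rho' := h.two_mul_rho_ip (0, 0, x) (0, e.2.1, 0) (0, s, 0)
  have h_fst := h.dorf_inr_fst hF x (0, s, 0) e.2.2
  rw [h.ip_inl, h.ip_inl, h.two_mul_ip, h.dorf_snd_snd_of_right _ _ rfl] at h_rho h_rho'
  simp only [map_zero, map_sub, map_add, LinearMap.sub_apply, LinearMap.add_apply,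
    LinearMap.zero_apply, mul_zero, sH] at h_rho h_rho' h_fst ⊢
  rw [fact, map_zero] at h_fst
  rw [hs (sR F ca x e.2.2)]
  simp only [sNabla]
  linear_combination h_rho' - h_rho - h_fst

lemma dorf_comm_fst_apply (h : IsStandardCA F (fun r s => lG r s) (fun r s => ipG r s) ca)
    (p q : Module.Dual A ↥F × G × ↥F) (w : ↥F) :
    (ca.dorf p q).1 w = - (ca.dorf q p).1 w + fact F w (2 * ca.ip p q) := by
  have h_sym := congrArg (fun e => e.1 w) (ca.dorf_sym p q)
  simp only [Prod.fst_add, LinearMap.add_apply,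
    h.Dmap_fst_apply, two_smul] at h_sym
  rw [fact] at h_sym ⊢
  rw [two_mul, map_add]
  linear_combination h_sym

lemma dorf_comm_snd_fst (h : IsStandardCA F (fun r s => lG r s) (fun r s => ipG r s) ca)
    (hG : ∀ r, (∀ s, ipG r s = 0) → r = 0) (p q : Module.Dual A ↥F × G × ↥F) :
    (ca.dorf p q).2.1 = - (ca.dorf q p).2.1 := by
  have h_sym := congrArg (fun e => e.2.1) (ca.dorf_sym p q)
  simp only [Prod.snd_add, Prod.fst_add, Prod.smul_snd, Prod.smul_fst, h.Dmap_snd_fst hG,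
    smul_zero] at h_sym
  exact eq_neg_of_add_eq_zero_left h_sym

/-- The `𝒢`-component of `e ∘ s` for a section `s` of `𝒢`. -/
lemma dorf_inl_snd_fst (h : IsStandardCA F (fun r s => lG r s) (fun r s => ipG r s) ca)
    (hG : ∀ r, (∀ s, ipG r s = 0) → r = 0) (e : Module.Dual A ↥F × G × ↥F) (s : G) :
    (ca.dorf e (0, s, 0)).2.1 = lG e.2.1 s + sNabla F ca e.2.2 s := by
  have h_fst : (ca.dorf (e.1, 0, 0) (0, s, 0)).2.1 = 0 := by
    rw [h.dorf_comm_snd_fst hG, neg_eq_zero]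
    refine hG _ fun t => two_mul_left_cancel_of_real ?_
    have h_rho := h.two_mul_rho_ip (0, s, 0) (e.1, 0, 0) (0, t, 0)
    rw [h.ip_inl, h.ip_inl, h.two_mul_ip, h.dorf_snd_snd_of_right _ _ rfl] at h_rho
    simpa [fact] using h_rho.symm
  have h_split : e = (e.1, 0, 0) + (0, e.2.1, 0) + (0, 0, e.2.2) := by simp
  conv_lhs => rw [h_split]
  simp only [map_add, LinearMap.add_apply, Prod.snd_add, Prod.fst_add, h_fst, zero_add, h.2.2,
    sNabla]

/-- The `𝒢`-component of `e ∘ z` for a section `z` of `F`. -/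
lemma dorf_right_inr_snd_fst (h : IsStandardCA F (fun r s => lG r s) (fun r s => ipG r s) ca)
    (hF : ∀ x y : ↥F, ⁅(x : Derivation ℝ A A), (y : Derivation ℝ A A)⁆ ∈ F)
    (hG : ∀ r, (∀ s, ipG r s = 0) → r = 0) (hs : ∀ r s, ipG r s = ipG s r)
    (e : Module.Dual A ↥F × G × ↥F) (z : ↥F) :
    (ca.dorf e (0, 0, z)).2.1 = sR F ca e.2.2 z - sNabla F ca z e.2.1 := by
  rw [h.dorf_comm_snd_fst hG, h.dorf_inr_snd_fst hF hG hs, sR, sR,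
    h.dorf_comm_snd_fst hG (0, 0, z)]
  abel

lemma sR_skew (h : IsStandardCA F (fun r s => lG r s) (fun r s => ipG r s) ca)
    (hG : ∀ r, (∀ s, ipG r s = 0) → r = 0) (x y : ↥F) : sR F ca x y = - sR F ca y x :=
  h.dorf_comm_snd_fst hG _ _

lemma sH_skew_left (h : IsStandardCA F (fun r s => lG r s) (fun r s => ipG r s) ca)
    (x y z : ↥F) : sH F ca x y z = - sH F ca y x z := by
  rw [sH, h.dorf_comm_fst_apply, h.two_mul_ip_inr, sH]
  simp [fact]

lemma sH_skew_right (h : IsStandardCA F (fun r s => lG r s) (fun r s => ipG r s) ca)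
    (hF : ∀ x y : ↥F, ⁅(x : Derivation ℝ A A), (y : Derivation ℝ A A)⁆ ∈ F)
    (x y z : ↥F) : sH F ca x y z = - sH F ca x z y := by
  rw [sH, h.dorf_inr_fst hF]
  simp [fact]

end IsStandardCA

end InducedData

/-- The value of `⟨R ∧ R⟩` for a skew-symmetric `R` and a symmetric pairing. -/
lemma pontR_eq {A : Type} [CommRing A] [Algebra ℝ A] (F : Submodule A (Derivation ℝ A A))
    {G : Type} [AddCommGroup G] [Module A G] (ipG : G →ₗ[A] G →ₗ[A] A)
    (hs : ∀ r s, ipG r s = ipG s r) (Rm : ↥F → ↥F → G) (hR : ∀ x y, Rm x y = - Rm y x)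
    (x₁ x₂ x₃ x₄ : ↥F) :
    pontR F (fun r s => ipG r s) Rm x₁ x₂ x₃ x₄ =
      2 * (ipG (Rm x₁ x₂) (Rm x₃ x₄) - ipG (Rm x₁ x₃) (Rm x₂ x₄)
        + ipG (Rm x₁ x₄) (Rm x₂ x₃)) := by
  have h_sum := sum_perm_four_sign_smul
    (fun i j k l => ipG (Rm (![x₁, x₂, x₃, x₄] i) (![x₁, x₂, x₃, x₄] j))
      (Rm (![x₁, x₂, x₃, x₄] k) (![x₁, x₂, x₃, x₄] l)))
    (fun i j k l => by rw [hR, map_neg, LinearMap.neg_apply]) (fun i j k l => hs _ _)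
  rw [pontR, h_sum, ← Int.cast_smul_eq_zsmul ℝ, smul_smul]
  rw [show (4 : ℝ)⁻¹ * ((8 : ℤ) : ℝ) = 2 by norm_num, two_smul, two_mul]
  rfl

open CourantAlgebroid in
/-- The induced data of a standard Courant algebroid structure on
`F*⊕𝒢⊕F` satisfy: (i) `∇` is metric; (ii) `∇` acts by derivations of `[-,-]_𝒢`;
(iii) the Bianchi-type identity; (iv) the curvature of `∇` is `ad_{R}`;
(v) `d^Fℋ = ⟨R∧R⟩`. -/
theorem statement9
    {A : Type} [CommRing A] [Algebra ℝ A]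
    (F : Submodule A (Derivation ℝ A A))
    (hF : ∀ x y : ↥F, ⁅(x : Derivation ℝ A A), (y : Derivation ℝ A A)⁆ ∈ F)
    {G : Type} [AddCommGroup G] [Module A G] [Module ℝ G] [IsScalarTower ℝ A G]
    -- 𝒢 is a bundle of quadratic Lie algebras
    (lG : G →ₗ[A] G →ₗ[A] G) (ipG : G →ₗ[A] G →ₗ[A] A)
    (lG_skew : ∀ r s, lG r s = - lG s r)
    (lG_jacobi : ∀ r s t, lG r (lG s t) = lG (lG r s) t + lG s (lG r t))
    (ipG_symm : ∀ r s, ipG r s = ipG s r)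
    (ipG_nondeg : ∀ r, (∀ s, ipG r s = 0) → r = 0)
    (ipG_ad : ∀ r s t, ipG (lG r s) t + ipG s (lG r t) = 0)
    -- a standard Courant algebroid structure on F*⊕𝒢⊕F
    (ca : CourantAlgebroid A (Module.Dual A ↥F × G × ↥F))
    (hstd : IsStandardCA F (fun r s => lG r s) (fun r s => ipG r s) ca) :
    -- (i) x⟨r,s⟩_𝒢 = ⟨∇_x r,s⟩_𝒢 + ⟨r,∇_x s⟩_𝒢
    (∀ (x : ↥F) (r s : G),
      fact F x (ipG r s) = ipG (sNabla F ca x r) s + ipG r (sNabla F ca x s)) ∧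
    -- (ii) ∇_x[r,s]_𝒢 = [∇_x r,s]_𝒢 + [r,∇_x s]_𝒢
    (∀ (x : ↥F) (r s : G),
      sNabla F ca x (lG r s) = lG (sNabla F ca x r) s + lG r (sNabla F ca x s)) ∧
    -- (iii) (∇_x R(y,z) − R([x,y],z)) + c.p. = 0
    (∀ x y z : ↥F,
      (sNabla F ca x (sR F ca y z) - sR F ca (fbk F hF x y) z)
        + (sNabla F ca y (sR F ca z x) - sR F ca (fbk F hF y z) x)
        + (sNabla F ca z (sR F ca x y) - sR F ca (fbk F hF z x) y) = 0) ∧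
    -- (iv) ∇_x∇_y r − ∇_y∇_x r − ∇_{[x,y]}r = [R(x,y),r]_𝒢
    (∀ (x y : ↥F) (r : G),
      sNabla F ca x (sNabla F ca y r) - sNabla F ca y (sNabla F ca x r)
        - sNabla F ca (fbk F hF x y) r = lG (sR F ca x y) r) ∧
    -- (v) d^Fℋ = ⟨R∧R⟩
    (∀ x₁ x₂ x₃ x₄ : ↥F,
      dCE3 (fact F) (fbk F hF) (sH F ca) x₁ x₂ x₃ x₄
        = pontR F (fun r s => ipG r s) (sR F ca) x₁ x₂ x₃ x₄) := by
  have inr_snd := hstd.dorf_inr_snd_fst hF ipG_nondeg ipG_symm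
  have inl_snd := hstd.dorf_inl_snd_fst ipG_nondeg
  have sR_skew := hstd.sR_skew ipG_nondeg
  refine ⟨fun x r s => ?_, fun x r s => ?_, fun x y z => ?_, fun x y r => ?_,
    fun x y z w => ?_⟩
  · have h_rho := ca.rho_ip (0, 0, x) (0, r, 0) (0, s, 0)
    rw [ca.ip_symm (0, r, 0) (ca.dorf _ _)] at h_rho
    simp only [hstd.ip_inl, hstd.1] at h_rho
    rw [fact, h_rho, sNabla, sNabla, ipG_symm r]
  · have h_jac := congrArg (fun e => e.2.1) (ca.dorf_jacobi (0, 0, x) (0, r, 0) (0, s, 0))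
    simp only [Prod.snd_add, Prod.fst_add] at h_jac
    rw [hstd.dorf_comm_snd_fst ipG_nondeg (0, r, 0) (ca.dorf (0, 0, x) _)] at h_jac
    simp only [inl_snd, inr_snd, hstd.dorf_snd_snd_of_right _ (_, _, 0) rfl, sR_zero_right,
      sNabla_zero_left, add_zero, zero_add, map_zero, LinearMap.zero_apply] at h_jac
    rw [h_jac, lG_skew r]
  · have h_jac := congrArg (fun e => e.2.1) (ca.dorf_jacobi (0, 0, x) (0, 0, y) (0, 0, z))
    simp only [Prod.snd_add, Prod.fst_add, inr_snd, hstd.dorf_snd_snd hF, sNabla_zero_right,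
      zero_add, hstd.dorf_right_inr_snd_fst hF ipG_nondeg ipG_symm (ca.dorf _ _)] at h_jac
    rw [fbk_skew hF x z, sR_neg_right, sR_skew x (fbk F hF y z), sR_skew y (fbk F hF z x),
      sR_skew x z, sNabla_neg_right, neg_neg] at h_jac
    rw [← sub_eq_zero] at h_jac
    rw [← h_jac]
    abel
  · have h_jac := congrArg (fun e => e.2.1) (ca.dorf_jacobi (0, 0, x) (0, 0, y) (0, r, 0))
    simp only [Prod.snd_add, Prod.fst_add, inr_snd, inl_snd,
      hstd.dorf_snd_snd_of_right _ (_, _, 0) rfl, sR_zero_right, sNabla_zero_right, add_zero,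
      zero_add, hstd.dorf_snd_snd hF (0, 0, x) (0, 0, y)] at h_jac
    rw [h_jac]
    abel
  · have h_jac := congrArg (fun e => e.1 w) (ca.dorf_jacobi (0, 0, x) (0, 0, y) (0, 0, z))
    simp only [Prod.fst_add, LinearMap.add_apply] at h_jac
    rw [hstd.dorf_comm_fst_apply (ca.dorf _ _) (0, 0, z), hstd.two_mul_ip_inr,
      hstd.dorf_inr_dorf_fst hF, hstd.dorf_inr_dorf_fst hF, hstd.dorf_inr_dorf_fst hF,
      ← sH] at h_jac
    have sH_cyc : ∀ a b c, sH F ca a b c = sH F ca c a b := fun a b c => by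
      rw [hstd.sH_skew_right hF a b c, hstd.sH_skew_left, neg_neg]
    rw [pontR_eq F ipG ipG_symm _ sR_skew, dCE3, ipG_symm (sR F ca x w)]
    rw [sH_cyc y z (fbk F hF x w), sH_cyc x w (fbk F hF y z), sH_cyc x y (fbk F hF z w),
      sH_cyc z w (fbk F hF x y), sH_cyc x z (fbk F hF y w), sH_cyc y w (fbk F hF x z)] at h_jac
    linear_combination h_jac
end

section
/- Let 𝒜 be a quadratic Lie algebroid with anchor a : 𝒜 → TM, F = a(𝒜), and kernel isomorphic as a bundle of quadratic Lie algebras to 𝒢. Then any hoist κ of 𝒜 determines an isomorphism 𝒜 ≅ 𝒜^s = 𝒢⊕F of quadratic Lie algebroids, where the transported Lie bracket on Γ(𝒜^s) is completely determined by an F-connection ∇ on 𝒢 and a bundle map R : ∧²F → 𝒢 satisfying conditions (i)-(iv), through: [r,s] = [r,s]_𝒢, [x,y] = R(x,y) + [x,y], [x,r] = ∇_x r, for r,s ∈ Γ(𝒢) and x,y ∈ Γ(F). -/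
/-! # Statement 11
Any hoist `κ` of a quadratic Lie algebroid `𝒜` determines an isomorphism
`𝒜 ≅ 𝒜^s = 𝒢⊕F`, and the transported Lie bracket is completely determined, through
`[r,s] = [r,s]_𝒢`, `[x,y] = R(x,y) + [x,y]`, `[x,r] = ∇_x r`, by the
`F`-connection `∇ = ∇^κ` and the bundle map `R = R^κ` which satisfy the
compatibility conditions (i)-(iv).

Algebraic model: `A` plays the role of `C^∞(M)` and vector fields are
`Derivation ℝ A A`. -/

/-- A quadratic Lie algebroid (in algebraic form): a Lie algebroid over `A` (playing the
role of `C^∞(M)`) together with a fiberwise nondegenerate ad-invariant symmetric bilinear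
form on the kernel of the anchor (here given as a symmetric bilinear form on `L`,
only its restriction to `ker a` being relevant). -/
structure QuadLieAlgebroid (A : Type) [CommRing A] [Algebra ℝ A]
    (L : Type) [AddCommGroup L] [Module A L] [Module ℝ L] [IsScalarTower ℝ A L] where
  /-- the anchor `a` -/
  anchor : L →ₗ[A] Derivation ℝ A A
  /-- the Lie bracket (ℝ-bilinear) -/
  bracket : L →ₗ[ℝ] L →ₗ[ℝ] L
  bracket_skew : ∀ X Y, bracket X Y = - bracket Y X
  jacobi : ∀ X Y Z,
    bracket X (bracket Y Z) = bracket (bracket X Y) Z + bracket Y (bracket X Z)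
  leibniz : ∀ (X : L) (f : A) (Y : L),
    bracket X (f • Y) = f • bracket X Y + anchor X f • Y
  anchor_bracket : ∀ X Y, anchor (bracket X Y) = ⁅anchor X, anchor Y⁆
  /-- the pairing `⟨-,-⟩_𝒢` on `𝒢 = ker a` -/
  ipG : L →ₗ[A] L →ₗ[A] A
  ipG_symm : ∀ r s, ipG r s = ipG s r
  ipG_nondeg : ∀ r ∈ LinearMap.ker anchor,
    (∀ s ∈ LinearMap.ker anchor, ipG r s = 0) → r = 0
  /-- `a(X)⟨r,s⟩_𝒢 = ⟨[X,r],s⟩_𝒢 + ⟨r,[X,s]⟩_𝒢` (for `X ∈ ker a` this is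
  ad-invariance of the fiberwise pairing) -/
  ipG_inv : ∀ (X r s : L), r ∈ LinearMap.ker anchor → s ∈ LinearMap.ker anchor →
    anchor X (ipG r s) = ipG (bracket X r) s + ipG r (bracket X s)

namespace QuadLieAlgebroid

variable {A : Type} [CommRing A] [Algebra ℝ A]
variable {L : Type} [AddCommGroup L] [Module A L] [Module ℝ L] [IsScalarTower ℝ A L]
variable (Q : QuadLieAlgebroid A L)

/-- `F := a(𝒜)`, the characteristic distribution. -/
abbrev Fq : Submodule A (Derivation ℝ A A) := LinearMap.range Q.anchor

/-- `𝒢 := ker a`. -/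
abbrev Kq : Submodule A L := LinearMap.ker Q.anchor

lemma lie_mem_range (x y : ↥Q.Fq) :
    ⁅(x : Derivation ℝ A A), (y : Derivation ℝ A A)⁆ ∈ Q.Fq := by
  obtain ⟨X, hX⟩ := x.2
  obtain ⟨Y, hY⟩ := y.2
  exact ⟨Q.bracket X Y, by rw [Q.anchor_bracket, hX, hY]⟩

/-- the (leafwise) Lie bracket of vector fields tangent to `F` -/
def fbk (x y : ↥Q.Fq) : ↥Q.Fq :=
  ⟨⁅(x : Derivation ℝ A A), (y : Derivation ℝ A A)⁆, Q.lie_mem_range x y⟩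

/-- the action of vector fields tangent to `F` on functions -/
def fact (x : ↥Q.Fq) (f : A) : A := (x : Derivation ℝ A A) f

lemma bracket_mem_ker (X : L) {r : L} (hr : r ∈ Q.Kq) : Q.bracket X r ∈ Q.Kq := by
  have h : Q.anchor (Q.bracket X r) = ⁅Q.anchor X, Q.anchor r⁆ := Q.anchor_bracket X r
  rw [LinearMap.mem_ker] at hr ⊢
  rw [h, hr, lie_zero]

/-- A hoist of `𝒜`: a section `κ : F → 𝒜` of the anchor. -/
structure Hoist where
  toFun : ↥Q.Fq →ₗ[A] L
  sect : ∀ x, Q.anchor (toFun x) = ↑x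

variable {Q}

/-- The curvature `R^κ(x,y) = [κ(x),κ(y)] − κ([x,y])` of a hoist. -/
def Hoist.curv (κ : Q.Hoist) (x y : ↥Q.Fq) : L :=
  Q.bracket (κ.toFun x) (κ.toFun y) - κ.toFun (Q.fbk x y)

lemma Hoist.curv_mem_ker (κ : Q.Hoist) (x y : ↥Q.Fq) : κ.curv x y ∈ Q.Kq := by
  rw [LinearMap.mem_ker, Hoist.curv, map_sub, Q.anchor_bracket, κ.sect, κ.sect, κ.sect]
  show ⁅(x : Derivation ℝ A A), (y : Derivation ℝ A A)⁆ - ↑(Q.fbk x y) = 0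
  rw [fbk]
  exact sub_self _

variable (Q)

/-- The 4-form `⟨R^κ∧R^κ⟩` representing the first Pontryagin class. -/
noncomputable def pont4 (κ : Q.Hoist) (x₁ x₂ x₃ x₄ : ↥Q.Fq) : A :=
  (4:ℝ)⁻¹ • ∑ σ : Equiv.Perm (Fin 4),
    (Equiv.Perm.sign σ : ℤ) •
      Q.ipG (κ.curv (![x₁, x₂, x₃, x₄] (σ 0)) (![x₁, x₂, x₃, x₄] (σ 1)))
            (κ.curv (![x₁, x₂, x₃, x₄] (σ 2)) (![x₁, x₂, x₃, x₄] (σ 3)))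

end QuadLieAlgebroid

namespace QuadLieAlgebroid

variable {A : Type} [CommRing A] [Algebra ℝ A]
variable {L : Type} [AddCommGroup L] [Module A L] [Module ℝ L] [IsScalarTower ℝ A L]
variable {Q : QuadLieAlgebroid A L}

/-- the fiberwise Lie bracket on `𝒢 = ker a` -/
def lGk (r s : ↥Q.Kq) : ↥Q.Kq := ⟨Q.bracket ↑r ↑s, Q.bracket_mem_ker _ s.2⟩

/-- the connection `∇^κ_x r = [κ(x), r]` induced by a hoist -/
def Hoist.nabla (κ : Q.Hoist) (x : ↥Q.Fq) (r : ↥Q.Kq) : ↥Q.Kq :=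
  ⟨Q.bracket (κ.toFun x) ↑r, Q.bracket_mem_ker _ r.2⟩

/-- the curvature `R^κ` viewed with values in `𝒢 = ker a` -/
def Hoist.curvK (κ : Q.Hoist) (x y : ↥Q.Fq) : ↥Q.Kq := ⟨κ.curv x y, κ.curv_mem_ker x y⟩

/-- the isomorphism `𝒜^s = 𝒢⊕F → 𝒜` determined by a hoist -/
def Hoist.toIso (κ : Q.Hoist) : (↥Q.Kq × ↥Q.Fq) →ₗ[A] L :=
  Q.Kq.subtype.comp (LinearMap.fst A ↥Q.Kq ↥Q.Fq)
    + κ.toFun.comp (LinearMap.snd A ↥Q.Kq ↥Q.Fq)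

/-- the standard bracket on `𝒜^s = 𝒢⊕F` determined by `(F,𝒢;∇,R)` -/
def stdBkt (Nb : ↥Q.Fq → ↥Q.Kq → ↥Q.Kq) (Rm : ↥Q.Fq → ↥Q.Fq → ↥Q.Kq)
    (p q : ↥Q.Kq × ↥Q.Fq) : ↥Q.Kq × ↥Q.Fq :=
  (lGk p.1 q.1 + Nb p.2 q.1 - Nb q.2 p.1 + Rm p.2 q.2, Q.fbk p.2 q.2)

end QuadLieAlgebroid

namespace QuadLieAlgebroid

variable {A : Type} [CommRing A] [Algebra ℝ A]
variable {L : Type} [AddCommGroup L] [Module A L] [Module ℝ L] [IsScalarTower ℝ A L]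
variable {Q : QuadLieAlgebroid A L}

lemma Hoist.toIso_apply (κ : Q.Hoist) (p : ↥Q.Kq × ↥Q.Fq) :
    κ.toIso p = ↑p.1 + κ.toFun p.2 := rfl

lemma Hoist.anchor_toIso (κ : Q.Hoist) (p : ↥Q.Kq × ↥Q.Fq) :
    Q.anchor (κ.toIso p) = ↑p.2 := by
  rw [κ.toIso_apply, map_add, κ.sect, LinearMap.mem_ker.mp p.1.2, zero_add]

lemma Hoist.toIso_bijective (κ : Q.Hoist) : Function.Bijective κ.toIso := by
  refine ⟨fun p q h ↦ ?_, fun X ↦ ?_⟩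
  · have h2 : p.2 = q.2 := Subtype.ext (by rw [← κ.anchor_toIso, h, κ.anchor_toIso])
    rw [κ.toIso_apply, κ.toIso_apply, h2] at h
    exact Prod.ext (Subtype.ext (add_right_cancel h)) h2
  · let x : ↥Q.Fq := ⟨Q.anchor X, LinearMap.mem_range_self _ X⟩
    have hX : X - κ.toFun x ∈ Q.Kq := by
      rw [LinearMap.mem_ker, map_sub, κ.sect, sub_self]
    exact ⟨(⟨X - κ.toFun x, hX⟩, x), sub_add_cancel X (κ.toFun x)⟩

lemma Hoist.bracket_toIso (κ : Q.Hoist) (p q : ↥Q.Kq × ↥Q.Fq) :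
    Q.bracket (κ.toIso p) (κ.toIso q) = κ.toIso (stdBkt κ.nabla κ.curvK p q) := by
  simp only [Hoist.toIso_apply, stdBkt, lGk, Hoist.nabla, Hoist.curvK, Hoist.curv,
    Submodule.coe_add, Submodule.coe_sub, map_add, LinearMap.add_apply]
  rw [Q.bracket_skew (↑p.1) (κ.toFun q.2)]
  abel

lemma Hoist.nabla_lGk (κ : Q.Hoist) (x : ↥Q.Fq) (r s : ↥Q.Kq) :
    κ.nabla x (lGk r s) = lGk (κ.nabla x r) s + lGk r (κ.nabla x s) :=
  Subtype.ext (Q.jacobi _ _ _)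

lemma bracket_cyclic (Q : QuadLieAlgebroid A L) (X Y Z : L) :
    Q.bracket X (Q.bracket Y Z) + Q.bracket Y (Q.bracket Z X)
      + Q.bracket Z (Q.bracket X Y) = 0 := by
  rw [Q.jacobi X Y Z, Q.bracket_skew Z X, map_neg, Q.bracket_skew Z (Q.bracket X Y)]
  abel

lemma fbk_cyclic (Q : QuadLieAlgebroid A L) (x y z : ↥Q.Fq) :
    Q.fbk (Q.fbk x y) z + Q.fbk (Q.fbk y z) x + Q.fbk (Q.fbk z x) y = 0 := by
  refine Subtype.ext ?_
  have h := lie_jacobi (x : Derivation ℝ A A) y z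
  rw [← lie_skew (x : Derivation ℝ A A) ⁅(y : Derivation ℝ A A), (z : Derivation ℝ A A)⁆,
    ← lie_skew (y : Derivation ℝ A A) ⁅(z : Derivation ℝ A A), (x : Derivation ℝ A A)⁆,
    ← lie_skew (z : Derivation ℝ A A) ⁅(x : Derivation ℝ A A), (y : Derivation ℝ A A)⁆,
    ← neg_add, ← neg_add, neg_eq_zero] at h
  simp only [fbk, Submodule.coe_add, Submodule.coe_zero]
  rw [← h]
  abel

/-- The Bianchi identity for the curvature of a hoist. -/
lemma Hoist.bianchi (κ : Q.Hoist) (x y z : ↥Q.Fq) :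
    (κ.nabla x (κ.curvK y z) - κ.curvK (Q.fbk x y) z)
      + (κ.nabla y (κ.curvK z x) - κ.curvK (Q.fbk y z) x)
      + (κ.nabla z (κ.curvK x y) - κ.curvK (Q.fbk z x) y) = 0 := by
  refine Subtype.ext ?_
  have hL := Q.bracket_cyclic (κ.toFun x) (κ.toFun y) (κ.toFun z)
  have hF := congrArg κ.toFun (Q.fbk_cyclic x y z)
  simp only [map_add, map_zero] at hF
  simp only [Hoist.nabla, Hoist.curvK, Hoist.curv, Submodule.coe_add, Submodule.coe_sub,
    Submodule.coe_zero, map_sub]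
  rw [Q.bracket_skew (κ.toFun (Q.fbk x y)), Q.bracket_skew (κ.toFun (Q.fbk y z)),
    Q.bracket_skew (κ.toFun (Q.fbk z x)), ← add_zero (0 : L)]
  nth_rewrite 1 [← hL]
  rw [← hF]
  abel

lemma Hoist.nabla_curvature (κ : Q.Hoist) (x y : ↥Q.Fq) (r : ↥Q.Kq) :
    κ.nabla x (κ.nabla y r) - κ.nabla y (κ.nabla x r) - κ.nabla (Q.fbk x y) r
      = lGk (κ.curvK x y) r := by
  refine Subtype.ext ?_
  simp only [Hoist.nabla, lGk, Hoist.curvK, Hoist.curv, Submodule.coe_sub, map_sub,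
    LinearMap.sub_apply]
  rw [Q.jacobi (κ.toFun x) (κ.toFun y)]
  abel

lemma Hoist.nabla_ipG (κ : Q.Hoist) (x : ↥Q.Fq) (r s : ↥Q.Kq) :
    Q.fact x (Q.ipG ↑r ↑s)
      = Q.ipG ↑(κ.nabla x r) ↑s + Q.ipG ↑r ↑(κ.nabla x s) := by
  rw [fact, ← κ.sect x]
  exact Q.ipG_inv _ _ _ r.2 s.2

end QuadLieAlgebroid

open QuadLieAlgebroid in
/-- A hoist `κ` of a quadratic Lie algebroid `𝒜` yields an
isomorphism `𝒜 ≅ 𝒜^s = 𝒢⊕F` of quadratic Lie algebroids; the transported bracket is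
the standard bracket determined by `∇ = ∇^κ` and `R = R^κ`, which satisfy the
compatibility conditions (i)-(iv). -/
theorem statement11
    {A : Type} [CommRing A] [Algebra ℝ A]
    {L : Type} [AddCommGroup L] [Module A L] [Module ℝ L] [IsScalarTower ℝ A L]
    (Q : QuadLieAlgebroid A L) (κ : Q.Hoist) :
    -- κ determines an isomorphism of vector bundles 𝒢⊕F ≅ 𝒜 ...
    Function.Bijective κ.toIso ∧
    -- ... commuting with the anchors (where 𝒜^s = 𝒢⊕F has anchor the projection to F)
    (∀ p : ↥Q.Kq × ↥Q.Fq, Q.anchor (κ.toIso p) = ↑p.2) ∧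
    -- ... transporting the Lie bracket of 𝒜 to the standard bracket on 𝒢⊕F
    -- determined by ∇ = ∇^κ and R = R^κ via
    -- [r,s] = [r,s]_𝒢, [x,y] = R(x,y) + [x,y], [x,r] = ∇_x r
    (∀ p q : ↥Q.Kq × ↥Q.Fq,
      Q.bracket (κ.toIso p) (κ.toIso q) = κ.toIso (stdBkt κ.nabla κ.curvK p q)) ∧
    -- ∇^κ and R^κ satisfy the compatibility conditions (i)-(iv):
    -- (i) x⟨r,s⟩_𝒢 = ⟨∇_x r,s⟩_𝒢 + ⟨r,∇_x s⟩_𝒢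
    (∀ (x : ↥Q.Fq) (r s : ↥Q.Kq),
      Q.fact x (Q.ipG ↑r ↑s)
        = Q.ipG ↑(κ.nabla x r) ↑s + Q.ipG ↑r ↑(κ.nabla x s)) ∧
    -- (ii) ∇_x[r,s]_𝒢 = [∇_x r,s]_𝒢 + [r,∇_x s]_𝒢
    (∀ (x : ↥Q.Fq) (r s : ↥Q.Kq),
      κ.nabla x (lGk r s) = lGk (κ.nabla x r) s + lGk r (κ.nabla x s)) ∧
    -- (iii) (∇_x R(y,z) − R([x,y],z)) + c.p. = 0
    (∀ x y z : ↥Q.Fq,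
      (κ.nabla x (κ.curvK y z) - κ.curvK (Q.fbk x y) z)
        + (κ.nabla y (κ.curvK z x) - κ.curvK (Q.fbk y z) x)
        + (κ.nabla z (κ.curvK x y) - κ.curvK (Q.fbk z x) y) = 0) ∧
    -- (iv) ∇_x∇_y r − ∇_y∇_x r − ∇_{[x,y]}r = [R(x,y),r]_𝒢
    (∀ (x y : ↥Q.Fq) (r : ↥Q.Kq),
      κ.nabla x (κ.nabla y r) - κ.nabla y (κ.nabla x r) - κ.nabla (Q.fbk x y) r
        = lGk (κ.curvK x y) r) := by
  exact ⟨κ.toIso_bijective, κ.anchor_toIso, κ.bracket_toIso, κ.nabla_ipG, κ.nabla_lGk,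
    κ.bianchi, κ.nabla_curvature⟩
end

section
/- Let 𝒜 be a regular quadratic Lie algebroid, (C,κ) a coherent pair on 𝒜, and J : F → 𝒢 a bundle map. Then (C + dΦ_J, κ − J) is also a coherent pair, and the standard Courant algebroids E^s(C,κ) and E^s(C + dΦ_J, κ − J) are isomorphic. -/
namespace QuadLieAlgebroid

variable {A : Type} [CommRing A] [Algebra ℝ A]
variable {L : Type} [AddCommGroup L] [Module A L] [Module ℝ L] [IsScalarTower ℝ A L]
variable {Q : QuadLieAlgebroid A L}

/-- modification `κ − J` of a hoist `κ` by a bundle map `J : F → 𝒢` -/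
def Hoist.sub (κ : Q.Hoist) (J : ↥Q.Fq →ₗ[A] ↥Q.Kq) : Q.Hoist where
  toFun := κ.toFun - Q.Kq.subtype.comp J
  sect := by
    intro x
    have hJ : Q.anchor ↑(J x) = 0 := by
      have := (J x).2
      rwa [LinearMap.mem_ker] at this
    simp only [LinearMap.sub_apply, map_sub, LinearMap.comp_apply, Submodule.coe_subtype]
    rw [κ.sect, hJ, sub_zero]

end QuadLieAlgebroid

open QuadLieAlgebroid in
/-- A closed 3-form on a quadratic Lie algebroid which is coherent with respect to the
hoist `κ`. -/
def IsKCoherent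
    {A : Type} [CommRing A] [Algebra ℝ A]
    {L : Type} [AddCommGroup L] [Module A L] [Module ℝ L] [IsScalarTower ℝ A L]
    (Q : QuadLieAlgebroid A L) (C : L → L → L → A) (κ : Q.Hoist) : Prop :=
  (∀ (f : A) X X' Y Z, C (f • X + X') Y Z = f * C X Y Z + C X' Y Z) ∧
  (∀ X Y Z, C X Y Z = - C Y X Z) ∧
  (∀ X Y Z, C X Y Z = - C X Z Y) ∧
  (∀ X₀ X₁ X₂ X₃,
    dCE3 (fun X f => Q.anchor X f) (fun X Y => Q.bracket X Y) C X₀ X₁ X₂ X₃ = 0) ∧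
  (∀ r s t, r ∈ Q.Kq → s ∈ Q.Kq → t ∈ Q.Kq → C r s t = - Q.ipG (Q.bracket r s) t) ∧
  (∀ r s, r ∈ Q.Kq → s ∈ Q.Kq → ∀ x, C r s (κ.toFun x) = 0) ∧
  (∀ r, r ∈ Q.Kq → ∀ x y, C r (κ.toFun x) (κ.toFun y) = Q.ipG r (κ.curv x y))

open QuadLieAlgebroid in
/-- `ca` is (a realization of) the standard Courant algebroid `E^s(𝒜;C,κ)` on
`F*⊕𝒢⊕F` determined by the quintuple `(F,𝒢;∇^κ,R^κ,ℋ^{(C,κ)})`, where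
`ℋ^{(C,κ)}(x,y,z) = C(κ(x),κ(y),κ(z))`. -/
def RealizesES
    {A : Type} [CommRing A] [Algebra ℝ A]
    {L : Type} [AddCommGroup L] [Module A L] [Module ℝ L] [IsScalarTower ℝ A L]
    (Q : QuadLieAlgebroid A L) (C : L → L → L → A) (κ : Q.Hoist)
    (ca : CourantAlgebroid A (Module.Dual A ↥Q.Fq × ↥Q.Kq × ↥Q.Fq)) : Prop :=
  IsStandardCA Q.Fq (fun r s => lGk r s) (fun r s => Q.ipG ↑r ↑s) ca ∧
  (∀ x r, sNabla Q.Fq ca x r = κ.nabla x r) ∧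
  (∀ x y, sR Q.Fq ca x y = κ.curvK x y) ∧
  (∀ x y z, sH Q.Fq ca x y z = C (κ.toFun x) (κ.toFun y) (κ.toFun z))

open QuadLieAlgebroid in
/-- the 2-form `Φ_J(r+x, s+y) = ⟨r,J(y)⟩_𝒢 − ⟨s,J(x)⟩_𝒢` on `𝒜`, written via the
splitting `𝒜 ≅ 𝒢⊕F` determined by the hoist `κ` -/
def PhiJform
    {A : Type} [CommRing A] [Algebra ℝ A]
    {L : Type} [AddCommGroup L] [Module A L] [Module ℝ L] [IsScalarTower ℝ A L]
    {Q : QuadLieAlgebroid A L} (κ : Q.Hoist) (J : ↥Q.Fq →ₗ[A] ↥Q.Kq)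
    (X Y : L) : A :=
  Q.ipG (X - κ.toFun (Q.anchor.rangeRestrict X)) ↑(J (Q.anchor.rangeRestrict Y))
    - Q.ipG (Y - κ.toFun (Q.anchor.rangeRestrict Y)) ↑(J (Q.anchor.rangeRestrict X))

namespace QuadLieAlgebroid

variable {A : Type} [CommRing A] [Algebra ℝ A]
variable {L : Type} [AddCommGroup L] [Module A L] [Module ℝ L] [IsScalarTower ℝ A L]

section Differential

variable (Q : QuadLieAlgebroid A L) (B : L →ₗ[A] L →ₗ[A] A)

/-- the differential of a `2`-form on a quadratic Lie algebroid -/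
abbrev d2 (ω : L → L → A) : L → L → L → A :=
  dCE2 (fun X f => Q.anchor X f) (fun X Y => Q.bracket X Y) ω

lemma bracket_smul_left (f : A) (X Y : L) :
    Q.bracket (f • X) Y = f • Q.bracket X Y - Q.anchor Y f • X := by
  rw [Q.bracket_skew, Q.leibniz, Q.bracket_skew Y X]
  module

lemma bracket_bracket_left (X Y Z : L) :
    Q.bracket (Q.bracket X Y) Z =
      Q.bracket X (Q.bracket Y Z) - Q.bracket Y (Q.bracket X Z) := by
  rw [Q.jacobi X Y Z]; abel

lemma anchor_bracket_apply (X Y : L) (f : A) :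
    Q.anchor (Q.bracket X Y) f = Q.anchor X (Q.anchor Y f) - Q.anchor Y (Q.anchor X f) := by
  rw [Q.anchor_bracket, Derivation.commutator_apply]

lemma d2_linear_left (f : A) (X X' Y Z : L) :
    Q.d2 (fun X Y => B X Y) (f • X + X') Y Z =
      f * Q.d2 (fun X Y => B X Y) X Y Z + Q.d2 (fun X Y => B X Y) X' Y Z := by
  simp only [d2, dCE2, map_add, map_smul, LinearMap.add_apply, LinearMap.smul_apply,
    Derivation.add_apply, Derivation.smul_apply, smul_eq_mul, Q.bracket_smul_left, map_sub,
    LinearMap.sub_apply, Derivation.leibniz]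
  ring

variable {B}

lemma d2_skew_left (hB : ∀ X Y, B X Y = - B Y X) (X Y Z : L) :
    Q.d2 (fun X Y => B X Y) X Y Z = - Q.d2 (fun X Y => B X Y) Y X Z := by
  simp only [d2, dCE2]
  rw [hB Y X, Q.bracket_skew Y X]
  simp only [map_neg, LinearMap.neg_apply]
  ring

lemma d2_skew_right (hB : ∀ X Y, B X Y = - B Y X) (X Y Z : L) :
    Q.d2 (fun X Y => B X Y) X Y Z = - Q.d2 (fun X Y => B X Y) X Z Y := by
  simp only [d2, dCE2]
  rw [hB Z Y, Q.bracket_skew Z Y]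
  simp only [map_neg, LinearMap.neg_apply]
  ring

lemma dCE3_d2 (hB : ∀ X Y, B X Y = - B Y X) (X₀ X₁ X₂ X₃ : L) :
    dCE3 (fun X f => Q.anchor X f) (fun X Y => Q.bracket X Y)
      (Q.d2 fun X Y => B X Y) X₀ X₁ X₂ X₃ = 0 := by
  simp only [d2, dCE3, dCE2, map_add, map_sub, anchor_bracket_apply, bracket_bracket_left,
    LinearMap.sub_apply]
  rw [Q.bracket_skew X₁ X₀, Q.bracket_skew X₂ X₀, Q.bracket_skew X₃ X₀, Q.bracket_skew X₂ X₁,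
    Q.bracket_skew X₃ X₁, Q.bracket_skew X₃ X₂,
    hB (Q.bracket X₂ X₃) (Q.bracket X₀ X₁), hB (Q.bracket X₁ X₃) (Q.bracket X₀ X₂),
    hB (Q.bracket X₁ X₂) (Q.bracket X₀ X₃)]
  simp only [map_neg, LinearMap.neg_apply]
  rw [Q.bracket_skew X₂ (Q.bracket X₀ X₁), Q.bracket_skew X₃ (Q.bracket X₀ X₁),
    Q.bracket_skew X₃ (Q.bracket X₀ X₂), Q.bracket_skew X₃ (Q.bracket X₁ X₂)]
  simp only [map_neg, map_sub, LinearMap.neg_apply, LinearMap.sub_apply, bracket_bracket_left]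
  ring

end Differential

variable {Q : QuadLieAlgebroid A L} (κ : Q.Hoist) (J : ↥Q.Fq →ₗ[A] ↥Q.Kq)

/-- `PhiJform` as a bilinear map -/
def PhiJlin : L →ₗ[A] L →ₗ[A] A :=
  LinearMap.mk₂ A (PhiJform κ J)
    (by intros; simp only [PhiJform, map_add, map_sub, LinearMap.add_apply, LinearMap.sub_apply,
          Submodule.coe_add]; ring)
    (by intros; simp only [PhiJform, map_smul, map_sub, LinearMap.smul_apply,
          LinearMap.sub_apply, Submodule.coe_smul, smul_eq_mul]; ring)
    (by intros; simp only [PhiJform, map_add, map_sub, LinearMap.add_apply, LinearMap.sub_apply,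
          Submodule.coe_add]; ring)
    (by intros; simp only [PhiJform, map_smul, map_sub, LinearMap.smul_apply,
          LinearMap.sub_apply, Submodule.coe_smul, smul_eq_mul]; ring)

lemma PhiJlin_skew (X Y : L) : PhiJlin κ J X Y = - PhiJlin κ J Y X := by
  simp only [PhiJlin, LinearMap.mk₂_apply, PhiJform]; ring

lemma anchor_coe (r : ↥Q.Kq) : Q.anchor (r : L) = 0 := r.2

lemma rangeRestrict_coe (r : ↥Q.Kq) : Q.anchor.rangeRestrict (r : L) = 0 :=
  Subtype.ext r.2

lemma rangeRestrict_hoist (x : ↥Q.Fq) : Q.anchor.rangeRestrict (κ.toFun x) = x :=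
  Subtype.ext (κ.sect x)

lemma Hoist.sub_apply (x : ↥Q.Fq) : (κ.sub J).toFun x = κ.toFun x - J x := rfl

lemma PhiJform_ker_ker (r s : ↥Q.Kq) : PhiJform κ J (r : L) s = 0 := by
  simp [PhiJform, rangeRestrict_coe]

lemma PhiJform_ker_hoist (r : ↥Q.Kq) (x : ↥Q.Fq) :
    PhiJform κ J (r : L) (κ.toFun x) = Q.ipG r (J x) := by
  simp [PhiJform, rangeRestrict_coe, rangeRestrict_hoist]

lemma PhiJform_hoist_ker (r : ↥Q.Kq) (x : ↥Q.Fq) :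
    PhiJform κ J (κ.toFun x) (r : L) = - Q.ipG r (J x) := by
  simp [PhiJform, rangeRestrict_coe, rangeRestrict_hoist]

lemma PhiJform_hoist_hoist (x y : ↥Q.Fq) :
    PhiJform κ J (κ.toFun x) (κ.toFun y) = 0 := by
  simp [PhiJform, rangeRestrict_hoist]

lemma PhiJlin_ker_hoist_sub (r : ↥Q.Kq) (x : ↥Q.Fq) :
    PhiJlin κ J r ((κ.sub J).toFun x) = Q.ipG r (J x) := by
  rw [Hoist.sub_apply, map_sub]
  change PhiJform κ J _ _ - PhiJform κ J _ _ = _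
  rw [PhiJform_ker_ker, PhiJform_ker_hoist, sub_zero]

/-- ad-invariance along the hoist -/
lemma Hoist.ipG_nabla (x : ↥Q.Fq) (r s : ↥Q.Kq) :
    (x : Derivation ℝ A A) (Q.ipG r s) = Q.ipG (κ.nabla x r) s + Q.ipG r (κ.nabla x s) := by
  rw [← κ.sect x]; exact Q.ipG_inv _ _ _ r.2 s.2

lemma ipG_lGk (r s t : ↥Q.Kq) : Q.ipG (lGk r s) t = Q.ipG r (lGk s t) := by
  have h := Q.ipG_inv s r t r.2 t.2
  rw [show Q.anchor (s : L) = 0 from s.2, Derivation.zero_apply] at h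
  simp only [lGk]
  rw [Q.bracket_skew r s, map_neg, LinearMap.neg_apply]
  linear_combination h

lemma lGk_skew (r s : ↥Q.Kq) : lGk r s = - lGk s r := Subtype.ext (Q.bracket_skew r s)

lemma ipG_lGk_rotate (r s t : ↥Q.Kq) : Q.ipG (lGk r s) t = Q.ipG (lGk s t) r := by
  rw [ipG_lGk, Q.ipG_symm]

lemma ipG_lGk_reverse (r s t : ↥Q.Kq) : Q.ipG (lGk r s) t = - Q.ipG (lGk t s) r := by
  rw [ipG_lGk_rotate, lGk_skew, Submodule.coe_neg, map_neg, LinearMap.neg_apply]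

lemma ipG_lGk_swap (r s t : ↥Q.Kq) : Q.ipG (lGk r s) t = - Q.ipG (lGk r t) s := by
  rw [ipG_lGk_reverse, ← ipG_lGk_rotate]

lemma Hoist.bracket_hoist (x y : ↥Q.Fq) :
    Q.bracket (κ.toFun x) (κ.toFun y) = κ.curvK x y + κ.toFun (Q.fbk x y) := by
  simp [Hoist.curvK, Hoist.curv]

lemma Hoist.bracket_hoist_coe (x : ↥Q.Fq) (r : ↥Q.Kq) :
    Q.bracket (κ.toFun x) r = κ.nabla x r := rfl

lemma Hoist.bracket_coe_hoist (x : ↥Q.Fq) (r : ↥Q.Kq) :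
    Q.bracket r (κ.toFun x) = ((- κ.nabla x r : ↥Q.Kq) : L) := Q.bracket_skew _ _

lemma bracket_coe_coe (r s : ↥Q.Kq) : Q.bracket (r : L) s = lGk r s := rfl

lemma Hoist.curvK_sub (x y : ↥Q.Fq) :
    (κ.sub J).curvK x y = κ.curvK x y - κ.nabla x (J y) + κ.nabla y (J x)
      + lGk (J x) (J y) + J (Q.fbk x y) := by
  apply Subtype.ext
  change Q.bracket (κ.toFun x - J x) (κ.toFun y - J y) -
    (κ.toFun (Q.fbk x y) - J (Q.fbk x y)) = _
  simp only [map_sub, LinearMap.sub_apply, Hoist.bracket_hoist, Hoist.bracket_hoist_coe,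
    Hoist.bracket_coe_hoist, bracket_coe_coe, Submodule.coe_add, Submodule.coe_sub,
    Submodule.coe_neg]
  abel

lemma Hoist.nabla_sub (x : ↥Q.Fq) (r : ↥Q.Kq) :
    (κ.sub J).nabla x r = κ.nabla x r - lGk (J x) r := by
  apply Subtype.ext
  change Q.bracket (κ.toFun x - J x) r = _
  simp [Hoist.nabla, lGk]

lemma Hoist.nabla_add (x : ↥Q.Fq) (r s : ↥Q.Kq) :
    κ.nabla x (r + s) = κ.nabla x r + κ.nabla x s :=
  Subtype.ext (by simp [Hoist.nabla])

lemma lGk_add_left (r s t : ↥Q.Kq) : lGk (r + s) t = lGk r t + lGk s t :=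
  Subtype.ext (by simp [lGk])

lemma lGk_add_right (r s t : ↥Q.Kq) : lGk t (r + s) = lGk t r + lGk t s :=
  Subtype.ext (by simp [lGk])


section Coherent

variable {κ} {C : L → L → L → A}

lemma _root_.IsKCoherent.sub_left (h : IsKCoherent Q C κ) (X X' Y Z : L) :
    C (X - X') Y Z = C X Y Z - C X' Y Z := by
  have := h.1 (-1) X' X Y Z
  rw [show (-1 : A) • X' + X = X - X' by module] at this
  rw [this]; ring

lemma _root_.IsKCoherent.sub_mid (h : IsKCoherent Q C κ) (X X' Y Z : L) :
    C Y (X - X') Z = C Y X Z - C Y X' Z := by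
  rw [h.2.1, h.sub_left, h.2.1 Y X, h.2.1 Y X']; ring

lemma _root_.IsKCoherent.sub_right (h : IsKCoherent Q C κ) (X X' Y Z : L) :
    C Y Z (X - X') = C Y Z X - C Y Z X' := by
  rw [h.2.2.1, h.sub_mid, h.2.2.1 Y Z X, h.2.2.1 Y Z X']; ring

lemma _root_.IsKCoherent.apply_ker (h : IsKCoherent Q C κ) (r s t : ↥Q.Kq) :
    C r s t = - Q.ipG (lGk r s) t := h.2.2.2.2.1 _ _ _ r.2 s.2 t.2

lemma _root_.IsKCoherent.apply_ker_ker_hoist (h : IsKCoherent Q C κ) (r s : ↥Q.Kq) (x : ↥Q.Fq) :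
    C r s (κ.toFun x) = 0 := h.2.2.2.2.2.1 _ _ r.2 s.2 x

lemma _root_.IsKCoherent.apply_ker_hoist_ker (h : IsKCoherent Q C κ) (r s : ↥Q.Kq) (x : ↥Q.Fq) :
    C r (κ.toFun x) s = 0 := by
  rw [h.2.2.1, h.apply_ker_ker_hoist, neg_zero]

lemma _root_.IsKCoherent.apply_hoist_ker_ker (h : IsKCoherent Q C κ) (r s : ↥Q.Kq) (x : ↥Q.Fq) :
    C (κ.toFun x) r s = 0 := by
  rw [h.2.1, h.apply_ker_hoist_ker, neg_zero]

lemma _root_.IsKCoherent.apply_ker_hoist_hoist (h : IsKCoherent Q C κ) (r : ↥Q.Kq) (x y : ↥Q.Fq) :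
    C r (κ.toFun x) (κ.toFun y) = Q.ipG r (κ.curvK x y) := h.2.2.2.2.2.2 _ r.2 x y

lemma _root_.IsKCoherent.apply_hoist_ker_hoist (h : IsKCoherent Q C κ) (r : ↥Q.Kq) (x y : ↥Q.Fq) :
    C (κ.toFun x) r (κ.toFun y) = - Q.ipG r (κ.curvK x y) := by
  rw [h.2.1, h.apply_ker_hoist_hoist]

lemma _root_.IsKCoherent.apply_hoist_hoist_ker (h : IsKCoherent Q C κ) (r : ↥Q.Kq) (x y : ↥Q.Fq) :
    C (κ.toFun x) (κ.toFun y) r = Q.ipG r (κ.curvK x y) := by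
  rw [h.2.2.1, h.apply_hoist_ker_hoist, neg_neg]

lemma d2_PhiJform_hoist_sub (x y z : ↥Q.Fq) :
    Q.d2 (PhiJform κ J) ((κ.sub J).toFun x) ((κ.sub J).toFun y) ((κ.sub J).toFun z) =
      - Q.ipG ((κ.sub J).curvK x y) (J z) + Q.ipG ((κ.sub J).curvK x z) (J y)
      - Q.ipG ((κ.sub J).curvK y z) (J x) := by
  have hΦ : ∀ X Y, PhiJform κ J X Y = PhiJlin κ J X Y := fun _ _ => rfl
  have h0 : ∀ x y, PhiJlin κ J ((κ.sub J).toFun x) ((κ.sub J).toFun y) = 0 := by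
    intro x y
    simp only [Hoist.sub_apply, map_sub, LinearMap.sub_apply, ← hΦ, PhiJform_ker_ker,
      PhiJform_ker_hoist, PhiJform_hoist_ker, PhiJform_hoist_hoist]
    rw [Q.ipG_symm (J y)]; ring
  simp only [d2, dCE2, hΦ, (κ.sub J).bracket_hoist, map_add, LinearMap.add_apply, h0,
    PhiJlin_ker_hoist_sub,
    map_zero]
  ring

lemma _root_.IsKCoherent.apply_hoist_sub (h : IsKCoherent Q C κ) (x y z : ↥Q.Fq) :
    C ((κ.sub J).toFun x) ((κ.sub J).toFun y) ((κ.sub J).toFun z) =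
      C (κ.toFun x) (κ.toFun y) (κ.toFun z) - Q.ipG (J x) (κ.curvK y z)
        + Q.ipG (J y) (κ.curvK x z) - Q.ipG (J z) (κ.curvK x y)
        + Q.ipG (lGk (J x) (J y)) (J z) := by
  simp only [Hoist.sub_apply, h.sub_left, h.sub_mid, h.sub_right, h.apply_ker,
    h.apply_ker_ker_hoist, h.apply_ker_hoist_ker, h.apply_hoist_ker_ker,
    h.apply_ker_hoist_hoist, h.apply_hoist_ker_hoist, h.apply_hoist_hoist_ker]
  ring

lemma _root_.IsKCoherent.add_d2 (h : IsKCoherent Q C κ) :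
    IsKCoherent Q (fun X Y Z => C X Y Z + Q.d2 (PhiJform κ J) X Y Z) (κ.sub J) := by
  have hs := PhiJlin_skew κ J
  have hΦ : ∀ X Y, PhiJform κ J X Y = PhiJlin κ J X Y := fun _ _ => rfl
  refine ⟨fun f X X' Y Z => ?_, fun X Y Z => ?_, fun X Y Z => ?_, fun X₀ X₁ X₂ X₃ => ?_,
    fun r s t hr hs' ht => ?_, fun r s hr hs' x => ?_, fun r hr x y => ?_⟩
  · have := Q.d2_linear_left (PhiJlin κ J) f X X' Y Z
    simp only [h.1 f X X' Y Z]
    change _ + Q.d2 (fun X Y => PhiJlin κ J X Y) _ _ _ =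
      _ * (_ + Q.d2 (fun X Y => PhiJlin κ J X Y) _ _ _) +
        (_ + Q.d2 (fun X Y => PhiJlin κ J X Y) _ _ _)
    rw [this]; ring
  · have := Q.d2_skew_left hs X Y Z
    change _ + Q.d2 (fun X Y => PhiJlin κ J X Y) _ _ _ =
      - (_ + Q.d2 (fun X Y => PhiJlin κ J X Y) _ _ _)
    rw [this, h.2.1]; ring
  · have := Q.d2_skew_right hs X Y Z
    change _ + Q.d2 (fun X Y => PhiJlin κ J X Y) _ _ _ =
      - (_ + Q.d2 (fun X Y => PhiJlin κ J X Y) _ _ _)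
    rw [this, h.2.2.1]; ring
  · have h1 := h.2.2.2.1 X₀ X₁ X₂ X₃
    have h2 := Q.dCE3_d2 hs X₀ X₁ X₂ X₃
    change dCE3 _ _ (fun X Y Z => C X Y Z + Q.d2 (fun X Y => PhiJlin κ J X Y) X Y Z) _ _ _ _ = 0
    generalize (Q.d2 fun X Y => PhiJlin κ J X Y) = D at h2 ⊢
    simp only [dCE3, map_add] at h1 h2 ⊢
    linear_combination h1 + h2
  · lift r to ↥Q.Kq using hr
    lift s to ↥Q.Kq using hs'
    lift t to ↥Q.Kq using ht
    simp only [d2, dCE2, PhiJform_ker_ker, bracket_coe_coe, h.apply_ker, map_zero]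
    ring
  · lift r to ↥Q.Kq using hr
    lift s to ↥Q.Kq using hs'
    simp only [d2, dCE2, Hoist.sub_apply, h.sub_right, h.apply_ker, h.apply_ker_ker_hoist, hΦ,
      map_sub, bracket_coe_coe, Hoist.bracket_coe_hoist]
    simp only [← hΦ, PhiJform_ker_ker, PhiJform_ker_hoist, anchor_coe, map_zero,
      LinearMap.sub_apply, Derivation.zero_apply]
    ring
  · lift r to ↥Q.Kq using hr
    change _ = Q.ipG r ((κ.sub J).curvK x y : L)
    have hC : C r ((κ.sub J).toFun x) ((κ.sub J).toFun y) =
        Q.ipG r (κ.curvK x y) - Q.ipG (lGk r (J x)) (J y) := by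
      simp only [Hoist.sub_apply, h.sub_mid, h.sub_right, h.apply_ker, h.apply_ker_ker_hoist,
        h.apply_ker_hoist_ker, h.apply_ker_hoist_hoist]
      ring
    have hd : Q.d2 (PhiJform κ J) r ((κ.sub J).toFun x) ((κ.sub J).toFun y) =
        - (x : Derivation ℝ A A) (Q.ipG r (J y)) + (y : Derivation ℝ A A) (Q.ipG r (J x))
        + Q.ipG ((κ.sub J).nabla x r) (J y) - Q.ipG ((κ.sub J).nabla y r) (J x)
        + Q.ipG r (J (Q.fbk x y)) := by
      simp only [d2, dCE2, hΦ, (κ.sub J).bracket_hoist, (κ.sub J).bracket_coe_hoist,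
        (κ.sub J).sect, anchor_coe, Derivation.zero_apply, PhiJlin_ker_hoist_sub, map_add,
        LinearMap.add_apply]
      rw [hs ((κ.sub J).toFun _) (r : L), PhiJlin_ker_hoist_sub,
        ← hΦ (Subtype.val _) (r : L), PhiJform_ker_ker]
      simp only [Submodule.coe_neg, map_neg, LinearMap.neg_apply]
      ring
    dsimp only
    rw [hC, hd]
    simp only [κ.ipG_nabla, κ.nabla_sub, κ.curvK_sub, Submodule.coe_add, Submodule.coe_sub,
      map_add, map_sub, LinearMap.sub_apply]
    rw [lGk_skew (J x) r, lGk_skew (J y) r]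
    have hinv := ipG_lGk r (J y) (J x)
    rw [lGk_skew (J y) (J x)] at hinv
    simp only [Submodule.coe_neg, map_neg, LinearMap.neg_apply] at *
    linear_combination - hinv

end Coherent

section StandardBracket

variable {κ} {C : L → L → L → A}
  {ca : CourantAlgebroid A (Module.Dual A ↥Q.Fq × ↥Q.Kq × ↥Q.Fq)}

lemma _root_.RealizesES.rho_apply (h : RealizesES Q C κ ca)
    (p : Module.Dual A ↥Q.Fq × ↥Q.Kq × ↥Q.Fq) : ca.rho p = p.2.2 := h.1.1 p

lemma _root_.RealizesES.two_mul_ip (h : RealizesES Q C κ ca)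
    (p q : Module.Dual A ↥Q.Fq × ↥Q.Kq × ↥Q.Fq) :
    2 * ca.ip p q = p.1 q.2.2 + q.1 p.2.2 + 2 * Q.ipG p.2.1 q.2.1 := by
  rw [h.1.2.1]
  have (a : A) : 2 * (2 : ℝ)⁻¹ • a = a := by
    rw [mul_smul_comm, two_mul, ← two_smul ℝ, smul_smul]
    norm_num
  rw [mul_add, mul_add, this, this]

lemma two_mul_cancel {a b : A} (h : 2 * a = 2 * b) : a = b := by
  have h' := congrArg (fun c => (2 : ℝ)⁻¹ • c) h
  simpa [two_mul, ← two_smul ℝ, smul_smul] using h'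

lemma two_mul_rho_ip (ca : CourantAlgebroid A (Module.Dual A ↥Q.Fq × ↥Q.Kq × ↥Q.Fq)) (e₁ e₂ e₃) :
    ca.rho e₁ (2 * ca.ip e₂ e₃) =
      2 * ca.ip (ca.dorf e₁ e₂) e₃ + 2 * ca.ip e₂ (ca.dorf e₁ e₃) := by
  rw [two_mul, map_add, ca.rho_ip]; ring

lemma _root_.RealizesES.dorf_snd_snd (h : RealizesES Q C κ ca)
    (p q : Module.Dual A ↥Q.Fq × ↥Q.Kq × ↥Q.Fq) :
    (ca.dorf p q).2.2 = Q.fbk p.2.2 q.2.2 := by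
  apply Subtype.ext
  rw [← h.rho_apply, ca.rho_dorf, h.rho_apply, h.rho_apply]
  rfl

lemma _root_.RealizesES.Dmap_eq (h : RealizesES Q C κ ca) (f : A) :
    (∀ x : ↥Q.Fq, (ca.Dmap f).1 x = (x : Derivation ℝ A A) f) ∧
      (ca.Dmap f).2.1 = 0 ∧ (ca.Dmap f).2.2 = 0 := by
  have h2 : (ca.Dmap f).2.2 = 0 := by
    apply Subtype.ext; rw [← h.rho_apply, ca.rho_D]; rfl
  have key : ∀ e, _ := fun e => ca.ip_D f e
  simp only [h.two_mul_ip, h2, h.rho_apply, map_zero, add_zero] at key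
  refine ⟨fun x => ?_, ?_, h2⟩
  · simpa using key (0, 0, x)
  · apply Subtype.ext
    refine Q.ipG_nondeg _ (ca.Dmap f).2.1.2 fun s hs => two_mul_cancel ?_
    simpa using key (0, ⟨s, hs⟩, 0)

lemma _root_.RealizesES.dorf_swap (h : RealizesES Q C κ ca)
    (p q : Module.Dual A ↥Q.Fq × ↥Q.Kq × ↥Q.Fq) :
    (∀ z : ↥Q.Fq, (ca.dorf p q).1 z =
        (z : Derivation ℝ A A) (2 * ca.ip q p) - (ca.dorf q p).1 z) ∧
      (ca.dorf p q).2.1 = - (ca.dorf q p).2.1 := by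
  have hD := h.Dmap_eq (ca.ip q p)
  rw [show ca.dorf p q = (2 : ℝ) • ca.Dmap (ca.ip q p) - ca.dorf q p by
    rw [← ca.dorf_sym]; abel]
  refine ⟨fun z => ?_, ?_⟩
  · simp [hD.1, two_mul, two_smul ℝ]
  · simp [hD.2.1]

lemma fbk_zero_right (x : ↥Q.Fq) : Q.fbk x 0 = 0 := Subtype.ext (lie_zero _)

lemma _root_.RealizesES.dorf_dual_right (h : RealizesES Q C κ ca)
    (p : Module.Dual A ↥Q.Fq × ↥Q.Kq × ↥Q.Fq) (η : Module.Dual A ↥Q.Fq) :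
    (ca.dorf p (η, 0, 0)).2.1 = 0 := by
  apply Subtype.ext
  refine Q.ipG_nondeg _ (Subtype.prop _) fun s hs => two_mul_cancel ?_
  have := two_mul_rho_ip ca p (η, 0, 0) (0, ⟨s, hs⟩, 0)
  simp only [h.two_mul_ip, h.dorf_snd_snd, fbk_zero_right] at this
  simpa using this.symm

lemma _root_.RealizesES.dorf_dual_left (h : RealizesES Q C κ ca)
    (p : Module.Dual A ↥Q.Fq × ↥Q.Kq × ↥Q.Fq) (η : Module.Dual A ↥Q.Fq) :
    (ca.dorf (η, 0, 0) p).2.1 = 0 := by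
  rw [(h.dorf_swap _ _).2, h.dorf_dual_right, neg_zero]

lemma eq_add_components (p : Module.Dual A ↥Q.Fq × ↥Q.Kq × ↥Q.Fq) :
    p = (p.1, 0, 0) + (0, p.2.1, 0) + (0, 0, p.2.2) := by
  simp

lemma _root_.RealizesES.dorf_snd_fst (h : RealizesES Q C κ ca)
    (p q : Module.Dual A ↥Q.Fq × ↥Q.Kq × ↥Q.Fq) :
    (ca.dorf p q).2.1 = κ.curvK p.2.2 q.2.2 - κ.nabla q.2.2 p.2.1 + κ.nabla p.2.2 q.2.1
      + lGk p.2.1 q.2.1 := by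
  have h1 := fun x r => h.2.1 x r
  have h2 := fun x y => h.2.2.1 x y
  simp only [sNabla, sR] at h1 h2
  conv_lhs => rw [eq_add_components p, eq_add_components q]
  simp only [map_add, LinearMap.add_apply, Prod.snd_add, Prod.fst_add, h.dorf_dual_left,
    h.dorf_dual_right, h1, h2, h.1.2.2, (h.dorf_swap (0, p.2.1, 0) (0, 0, q.2.2)).2]
  abel

/-- the `F*`-component of the bracket with a section of `F` -/
lemma _root_.RealizesES.dorf_fst_of_tangent (h : RealizesES Q C κ ca)
    (p : Module.Dual A ↥Q.Fq × ↥Q.Kq × ↥Q.Fq) (y z : ↥Q.Fq) :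
    (ca.dorf p (0, 0, y)).1 z = C (κ.toFun p.2.2) (κ.toFun y) (κ.toFun z)
      + 2 * Q.ipG p.2.1 (κ.curvK y z) - (y : Derivation ℝ A A) (p.1 z) + p.1 (Q.fbk y z)
      + (z : Derivation ℝ A A) (p.1 y) := by
  have h3 := fun x y z => h.2.2.2 x y z
  simp only [sH] at h3
  have hr : ∀ r, (ca.dorf (0, 0, y) (0, r, 0)).1 z = - (2 * Q.ipG r (κ.curvK y z)) := by
    intro r
    have := two_mul_rho_ip ca (0, 0, y) (0, r, 0) (0, 0, z)
    simp only [h.two_mul_ip, h.dorf_snd_snd, h.dorf_snd_fst, fbk_zero_right] at this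
    simp [Hoist.nabla, lGk] at this
    linear_combination - this
  have hξ : ∀ ξ : Module.Dual A ↥Q.Fq, (ca.dorf (0, 0, y) (ξ, 0, 0)).1 z =
      (y : Derivation ℝ A A) (ξ z) - ξ (Q.fbk y z) := by
    intro ξ
    have := two_mul_rho_ip ca (0, 0, y) (ξ, 0, 0) (0, 0, z)
    simp only [h.two_mul_ip, h.dorf_snd_snd, h.rho_apply, fbk_zero_right] at this
    simp at this
    linear_combination - this
  conv_lhs => rw [eq_add_components p]
  simp only [map_add, LinearMap.add_apply, Prod.fst_add, h3,
    (h.dorf_swap (0, p.2.1, 0) (0, 0, y)).1, (h.dorf_swap (p.1, 0, 0) (0, 0, y)).1, hr, hξ,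
    h.two_mul_ip]
  simp
  ring

lemma _root_.RealizesES.dorf_fst (h : RealizesES Q C κ ca)
    (p q : Module.Dual A ↥Q.Fq × ↥Q.Kq × ↥Q.Fq) (z : ↥Q.Fq) :
    (ca.dorf p q).1 z = (p.2.2 : Derivation ℝ A A) (q.1 z) - q.1 (Q.fbk p.2.2 z)
      - (C (κ.toFun p.2.2) (κ.toFun z) (κ.toFun q.2.2)
        + 2 * Q.ipG p.2.1 (κ.curvK z q.2.2) - (z : Derivation ℝ A A) (p.1 q.2.2)
        + p.1 (Q.fbk z q.2.2) + (q.2.2 : Derivation ℝ A A) (p.1 z))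
      - 2 * Q.ipG q.2.1 (κ.curvK p.2.2 z) + 2 * Q.ipG q.2.1 (κ.nabla z p.2.1) := by
  have := two_mul_rho_ip ca p q (0, 0, z)
  simp only [h.two_mul_ip, h.dorf_snd_snd, h.dorf_snd_fst, h.rho_apply,
    h.dorf_fst_of_tangent] at this
  simp [Hoist.nabla, lGk] at this
  simp only [Hoist.nabla]
  linear_combination - this

end StandardBracket

/-- the bundle map `r ↦ ⟨r, J(-)⟩` from `𝒢` to `F*` -/
def pairJ : ↥Q.Kq →ₗ[A] Module.Dual A ↥Q.Fq :=
  Q.ipG.compl₁₂ Q.Kq.subtype (Q.Kq.subtype ∘ₗ J)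

lemma pairJ_apply (r : ↥Q.Kq) (x : ↥Q.Fq) : pairJ J r x = Q.ipG r (J x) := rfl

/-- the change of splitting `(ξ, r, x) ↦ (ξ − 2⟨r, J⟩ − ⟨J x, J⟩, r + J x, x)` -/
def changeSplitting :
    (Module.Dual A ↥Q.Fq × ↥Q.Kq × ↥Q.Fq) ≃ₗ[A] (Module.Dual A ↥Q.Fq × ↥Q.Kq × ↥Q.Fq) where
  toFun p := (p.1 - (2 : A) • pairJ J p.2.1 - pairJ J (J p.2.2), p.2.1 + J p.2.2, p.2.2)
  invFun p := (p.1 + (2 : A) • pairJ J p.2.1 - pairJ J (J p.2.2), p.2.1 - J p.2.2, p.2.2)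
  map_add' p q := by
    simp only [Prod.fst_add, Prod.snd_add, map_add, Prod.mk_add_mk, Prod.mk.injEq, and_true]
    exact ⟨by module, by abel⟩
  map_smul' c p := by
    simp only [Prod.smul_fst, Prod.smul_snd, map_smul, Prod.smul_mk, Prod.mk.injEq, and_true,
      RingHom.id_apply]
    exact ⟨by module, by module⟩
  left_inv p := by
    refine Prod.ext ?_ (Prod.ext ?_ rfl)
    · simp only [map_add]; module
    · simp
  right_inv p := by
    refine Prod.ext ?_ (Prod.ext ?_ rfl)
    · simp only [map_sub]; module
    · simp

lemma changeSplitting_apply (p : Module.Dual A ↥Q.Fq × ↥Q.Kq × ↥Q.Fq) :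
    changeSplitting J p =
      (p.1 - (2 : A) • pairJ J p.2.1 - pairJ J (J p.2.2), p.2.1 + J p.2.2, p.2.2) := rfl

lemma changeSplitting_dorf {κ : Q.Hoist} {C : L → L → L → A} (hcoh : IsKCoherent Q C κ)
    {ca₁ ca₂ : CourantAlgebroid A (Module.Dual A ↥Q.Fq × ↥Q.Kq × ↥Q.Fq)}
    (h₁ : RealizesES Q C κ ca₁)
    (h₂ : RealizesES Q (fun X Y Z => C X Y Z + Q.d2 (PhiJform κ J) X Y Z) (κ.sub J) ca₂)
    (p q : Module.Dual A ↥Q.Fq × ↥Q.Kq × ↥Q.Fq) :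
    changeSplitting J (ca₁.dorf p q) =
      ca₂.dorf (changeSplitting J p) (changeSplitting J q) := by
  refine Prod.ext (LinearMap.ext fun z => ?_) (Prod.ext ?_ ?_)
  · obtain ⟨ξ, r, x⟩ := p
    obtain ⟨η, s, y⟩ := q
    simp only [changeSplitting_apply, h₂.dorf_fst, LinearMap.sub_apply, LinearMap.smul_apply,
      h₁.dorf_fst, h₁.dorf_snd_snd, h₁.dorf_snd_fst, pairJ_apply, hcoh.apply_hoist_sub,
      d2_PhiJform_hoist_sub, κ.curvK_sub, κ.nabla_sub, Submodule.coe_add, Submodule.coe_sub,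
      map_add, map_sub, LinearMap.add_apply, smul_eq_mul, κ.nabla_add, lGk_add_right,
      two_mul, κ.ipG_nabla]
    simp only [← ipG_lGk]
    have S := fun a b : ↥Q.Kq => Q.ipG_symm a b
    linear_combination S (J z) (κ.curvK x y) - S (J y) (κ.nabla x (J z))
      + S (J y) (J (Q.fbk x z)) + S (J x) (κ.curvK z y) + S (J y) (κ.curvK x z)
      - S (J x) (κ.nabla z (J y)) + S (J x) (κ.nabla y (J z)) + S (J x) (J (Q.fbk z y))
      - 2 * S (J y) (κ.nabla z r) - 2 * ipG_lGk_rotate r s (J z)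
      + 2 * ipG_lGk_reverse r (J z) (J y) + 2 * ipG_lGk_swap s (J x) (J z)
      + 2 * ipG_lGk_swap (J x) (J z) (J y) + 2 * ipG_lGk_swap (J y) (J x) (J z)
      - ipG_lGk_reverse (J x) (J y) (J z)
  · simp only [changeSplitting_apply, h₂.dorf_snd_fst, h₁.dorf_snd_fst, h₁.dorf_snd_snd,
      κ.curvK_sub, κ.nabla_sub, κ.nabla_add, lGk_add_left, lGk_add_right]
    rw [lGk_skew (J q.2.2) p.2.1, lGk_skew (J q.2.2) (J p.2.2)]
    abel
  · simp only [changeSplitting_apply, h₂.dorf_snd_snd, h₁.dorf_snd_snd]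

end QuadLieAlgebroid

open QuadLieAlgebroid in
/-- `(C + dΦ_J, κ − J)` is a coherent pair and
`E^s(C,κ) ≅ E^s(C + dΦ_J, κ − J)` as Courant algebroids. -/
theorem statement16
    {A : Type} [CommRing A] [Algebra ℝ A]
    {L : Type} [AddCommGroup L] [Module A L] [Module ℝ L] [IsScalarTower ℝ A L]
    (Q : QuadLieAlgebroid A L) (C : L → L → L → A) (κ : Q.Hoist)
    (hcoh : IsKCoherent Q C κ) (J : ↥Q.Fq →ₗ[A] ↥Q.Kq) :
    -- (C + dΦ_J, κ − J) is a coherent pair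
    IsKCoherent Q
      (fun X Y Z => C X Y Z +
        dCE2 (fun X f => Q.anchor X f) (fun X Y => Q.bracket X Y) (PhiJform κ J) X Y Z)
      (κ.sub J) ∧
    -- the standard Courant algebroids E^s(C,κ) and E^s(C + dΦ_J, κ − J) are isomorphic
    (∀ ca₁ ca₂ : CourantAlgebroid A (Module.Dual A ↥Q.Fq × ↥Q.Kq × ↥Q.Fq),
      RealizesES Q C κ ca₁ →
      RealizesES Q
        (fun X Y Z => C X Y Z +
          dCE2 (fun X f => Q.anchor X f) (fun X Y => Q.bracket X Y) (PhiJform κ J) X Y Z)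
        (κ.sub J) ca₂ →
      ∃ Θ : (Module.Dual A ↥Q.Fq × ↥Q.Kq × ↥Q.Fq) ≃ₗ[A]
          (Module.Dual A ↥Q.Fq × ↥Q.Kq × ↥Q.Fq),
        (∀ p, ca₂.rho (Θ p) = ca₁.rho p) ∧
        (∀ p q, ca₂.ip (Θ p) (Θ q) = ca₁.ip p q) ∧
        (∀ p q, Θ (ca₁.dorf p q) = ca₂.dorf (Θ p) (Θ q))) := by
  refine ⟨hcoh.add_d2 J, fun ca₁ ca₂ h₁ h₂ => ⟨changeSplitting J, fun p => ?_, fun p q => ?_,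
    changeSplitting_dorf J hcoh h₁ h₂⟩⟩
  · rw [h₂.rho_apply, h₁.rho_apply, changeSplitting_apply]
  · apply two_mul_cancel
    rw [h₂.two_mul_ip, h₁.two_mul_ip]
    simp only [changeSplitting_apply, LinearMap.sub_apply, LinearMap.smul_apply, pairJ_apply,
      Submodule.coe_add, map_add, LinearMap.add_apply, smul_eq_mul]
    linear_combination 2 * Q.ipG_symm (J p.2.2) q.2.1 + Q.ipG_symm (J p.2.2) (J q.2.2)
end
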